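/- arXiv:2605.19784 — 7 statements merged into one kernel-verified Lean document; each statement's English description precedes it below -/
import Mathlib

section
/- A measure ν⋆ ∈ M₊(𝒳) minimizes J over M₊(𝒳) if and only if J'_{ν⋆}(t) ≥ 0 for every t ∈ 𝒳 and J'_{ν⋆}(t) = 0 for every t in the support of ν⋆. -/
/-!
STATEMENT 0 (KKT optimality conditions for the BLASSO):
A measure ν⋆ ∈ M₊(𝒳) minimizes J over M₊(𝒳) if and only if J'_{ν⋆}(t) ≥ 0 for every
t ∈ 𝒳 and J'_{ν⋆}(t) = 0 for every t in the support of ν⋆.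
-/

open MeasureTheory Set
open scoped RealInnerProductSpace ENNReal

noncomputable section

/-- The forward operator `Φ μ := ∫_𝒳 φ_t dμ(t)` (Bochner integral). -/
def PhiOp {d : ℕ} {H : Type*} [NormedAddCommGroup H] [InnerProductSpace ℝ H]
    (X : Set (EuclideanSpace ℝ (Fin d))) (φ : EuclideanSpace ℝ (Fin d) → H)
    (μ : Measure (EuclideanSpace ℝ (Fin d))) : H :=
  ∫ t in X, φ t ∂μ

/-- The BLASSO objective `J(μ) := (1/2)‖y − Φμ‖² + κ‖μ‖_TV`, where ‖μ‖_TV = μ(𝒳) for a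
nonnegative measure supported on 𝒳. -/
def Jobj {d : ℕ} {H : Type*} [NormedAddCommGroup H] [InnerProductSpace ℝ H]
    (X : Set (EuclideanSpace ℝ (Fin d))) (φ : EuclideanSpace ℝ (Fin d) → H)
    (y : H) (κ : ℝ) (μ : Measure (EuclideanSpace ℝ (Fin d))) : ℝ :=
  (1 / 2) * ‖y - PhiOp X φ μ‖ ^ 2 + κ * (μ X).toReal

/-- The dual certificate `J'_ν(t) := ⟨φ_t, Φν − y⟩ + κ`. -/
def dualCert {d : ℕ} {H : Type*} [NormedAddCommGroup H] [InnerProductSpace ℝ H]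
    (X : Set (EuclideanSpace ℝ (Fin d))) (φ : EuclideanSpace ℝ (Fin d) → H)
    (y : H) (κ : ℝ) (ν : Measure (EuclideanSpace ℝ (Fin d)))
    (t : EuclideanSpace ℝ (Fin d)) : ℝ :=
  ⟪φ t, PhiOp X φ ν - y⟫ + κ

/-- The (topological) support of a measure: points all of whose neighborhoods have
positive measure. -/
def msupport {d : ℕ} (μ : Measure (EuclideanSpace ℝ (Fin d))) :
    Set (EuclideanSpace ℝ (Fin d)) :=
  {x | ∀ U ∈ nhds x, μ U ≠ 0}

lemma quad_aux (a b : ℝ) (ha : 0 ≤ a)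
    (h : ∀ ε : ℝ, 0 < ε → ε ≤ 1 → 0 ≤ ε ^ 2 * a + ε * b) : 0 ≤ b := by
  by_contra hb
  push Not at hb
  have hp : 0 < a - b + 1 := by linarith
  have h1 : 0 < -b / (a - b + 1) := div_pos (by linarith) hp
  have h2 : -b / (a - b + 1) ≤ 1 := by rw [div_le_one hp]; linarith
  have h3 := h _ h1 h2
  have h4 : -b / (a - b + 1) * (a - b + 1) = -b := div_mul_cancel₀ _ hp.ne'
  set e := -b / (a - b + 1)
  have h5 : 0 ≤ e * (e * a + b) := by nlinarith
  have h6 : e * a + b < 0 := by nlinarith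
  nlinarith

section aux
variable {d : ℕ} {H : Type*} [NormedAddCommGroup H] [InnerProductSpace ℝ H] [CompleteSpace H]
    (X : Set (EuclideanSpace ℝ (Fin d))) (hX : IsCompact X)
    (φ : EuclideanSpace ℝ (Fin d) → H) (hφ : ContinuousOn φ X)
    (y : H) (κ : ℝ) (ν μ : Measure (EuclideanSpace ℝ (Fin d)))

lemma int_phi (hX : IsCompact X) (hφ : ContinuousOn φ X) [IsFiniteMeasure μ] :
    Integrable φ (μ.restrict X) :=
  hφ.integrableOn_compact hX

lemma int_cert (hX : IsCompact X) (hφ : ContinuousOn φ X) [IsFiniteMeasure μ] :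
    Integrable (dualCert X φ y κ ν) (μ.restrict X) := by
  unfold dualCert
  exact ((int_phi X φ μ hX hφ).inner_const _).add (integrable_const _)

lemma integral_cert (hX : IsCompact X) (hφ : ContinuousOn φ X) [IsFiniteMeasure μ] :
    ∫ t in X, dualCert X φ y κ ν t ∂μ
      = ⟪PhiOp X φ μ, PhiOp X φ ν - y⟫ + κ * (μ X).toReal := by
  have hi := int_phi X φ μ hX hφ
  unfold dualCert
  rw [integral_add (hi.inner_const _) (integrable_const _)]
  congr 1
  · simp_rw [real_inner_comm (PhiOp X φ ν - y)]
    rw [integral_inner hi]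
    rfl
  · simp [Measure.real, mul_comm]

lemma J_diff (hX : IsCompact X) (hφ : ContinuousOn φ X) [IsFiniteMeasure μ]
    [IsFiniteMeasure ν] :
    Jobj X φ y κ μ - Jobj X φ y κ ν = (1 / 2) * ‖PhiOp X φ μ - PhiOp X φ ν‖ ^ 2
      + ∫ t in X, dualCert X φ y κ ν t ∂μ - ∫ t in X, dualCert X φ y κ ν t ∂ν := by
  rw [integral_cert X φ y κ ν μ hX hφ, integral_cert X φ y κ ν ν hX hφ]
  unfold Jobj
  have : y - PhiOp X φ μ = -((PhiOp X φ μ - PhiOp X φ ν) + (PhiOp X φ ν - y)) := by abel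
  rw [this, norm_neg, norm_add_sq_real, norm_sub_rev y, inner_sub_left]
  ring

end aux

theorem kkt_optimality
    {d : ℕ} {H : Type*} [NormedAddCommGroup H] [InnerProductSpace ℝ H] [CompleteSpace H]
    [TopologicalSpace.SeparableSpace H]
    (hd : 1 ≤ d)
    (X : Set (EuclideanSpace ℝ (Fin d))) (hXcomp : IsCompact X) (hXconv : Convex ℝ X)
    (hXint : (interior X).Nonempty)
    (φ : EuclideanSpace ℝ (Fin d) → H) (hφ : ContinuousOn φ X)
    (y : H) (κ : ℝ) (hκ : 0 < κ)
    (νstar : Measure (EuclideanSpace ℝ (Fin d))) (hfin : IsFiniteMeasure νstar)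
    (hsupp : νstar Xᶜ = 0) :
    (∀ μ : Measure (EuclideanSpace ℝ (Fin d)), IsFiniteMeasure μ → μ Xᶜ = 0 →
        Jobj X φ y κ νstar ≤ Jobj X φ y κ μ) ↔
      ((∀ t ∈ X, 0 ≤ dualCert X φ y κ νstar t) ∧
        (∀ t ∈ msupport νstar, dualCert X φ y κ νstar t = 0)) := by
  classical
  have hXm : MeasurableSet X := hXcomp.measurableSet
  have hae : ∀ᵐ t ∂νstar, t ∈ X := by rw [ae_iff]; exact hsupp
  constructor
  · intro hmin
    have h1 : ∀ t ∈ X, 0 ≤ dualCert X φ y κ νstar t := by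
      intro t ht
      refine quad_aux ((1 / 2) * ‖φ t‖ ^ 2) _ (by positivity) ?_
      intro ε hε _
      have hfm : IsFiniteMeasure (ENNReal.ofReal ε • Measure.dirac t) :=
        Measure.smul_finite _ ENNReal.ofReal_ne_top
      have hm := hmin (νstar + ENNReal.ofReal ε • Measure.dirac t) inferInstance
        (by simp [hsupp, ht, hXm])
      have hd := J_diff X φ y κ νstar (νstar + ENNReal.ofReal ε • Measure.dirac t) hXcomp hφ
      have e1 : PhiOp X φ (νstar + ENNReal.ofReal ε • Measure.dirac t)
          = PhiOp X φ νstar + ε • φ t := by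
        unfold PhiOp
        rw [Measure.restrict_add, integral_add_measure (int_phi X φ _ hXcomp hφ)
          (int_phi X φ _ hXcomp hφ), Measure.restrict_smul, integral_smul_measure,
          restrict_dirac' hXm, if_pos ht, integral_dirac, ENNReal.toReal_ofReal hε.le]
      have e2 : ∫ s in X, dualCert X φ y κ νstar s ∂(νstar + ENNReal.ofReal ε • Measure.dirac t)
          = ∫ s in X, dualCert X φ y κ νstar s ∂νstar + ε * dualCert X φ y κ νstar t := by
        rw [Measure.restrict_add, integral_add_measure (int_cert X φ y κ _ _ hXcomp hφ)
          (int_cert X φ y κ _ _ hXcomp hφ), Measure.restrict_smul, integral_smul_measure,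
          restrict_dirac' hXm, if_pos ht, integral_dirac, ENNReal.toReal_ofReal hε.le, smul_eq_mul]
      rw [e1, e2, add_sub_cancel_left, norm_smul, mul_pow, Real.norm_eq_abs, sq_abs] at hd
      linarith
    refine ⟨h1, ?_⟩
    have h2 : 0 ≤ -∫ s in X, dualCert X φ y κ νstar s ∂νstar := by
      refine quad_aux ((1 / 2) * ‖PhiOp X φ νstar‖ ^ 2) _ (by positivity) ?_
      intro ε hε hε1
      have h0 : 0 ≤ 1 - ε := by linarith
      have hfm : IsFiniteMeasure (ENNReal.ofReal (1 - ε) • νstar) :=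
        Measure.smul_finite _ ENNReal.ofReal_ne_top
      have hm := hmin (ENNReal.ofReal (1 - ε) • νstar) inferInstance (by simp [hsupp])
      have hd := J_diff X φ y κ νstar (ENNReal.ofReal (1 - ε) • νstar) hXcomp hφ
      have e1 : PhiOp X φ (ENNReal.ofReal (1 - ε) • νstar) - PhiOp X φ νstar
          = (-ε) • PhiOp X φ νstar := by
        unfold PhiOp
        rw [Measure.restrict_smul, integral_smul_measure, ENNReal.toReal_ofReal h0]
        module
      rw [e1, Measure.restrict_smul, integral_smul_measure, ENNReal.toReal_ofReal h0, norm_smul,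
        mul_pow, Real.norm_eq_abs, sq_abs, smul_eq_mul] at hd
      linarith
    have hnn : 0 ≤ᵐ[νstar.restrict X] dualCert X φ y κ νstar := by
      filter_upwards [ae_restrict_mem hXm] with t ht using h1 t ht
    have h3 : ∫ s in X, dualCert X φ y κ νstar s ∂νstar = 0 :=
      le_antisymm (by linarith) (integral_nonneg_of_ae hnn)
    rw [integral_eq_zero_iff_of_nonneg_ae hnn (int_cert X φ y κ _ _ hXcomp hφ),
      Measure.restrict_eq_self_of_ae_mem hae] at h3
    intro t ht
    have htX : t ∈ X := by
      by_contra hn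
      exact ht _ (hXcomp.isClosed.isOpen_compl.mem_nhds hn) hsupp
    by_contra hne
    have hc : ContinuousOn (dualCert X φ y κ νstar) X := by
      unfold dualCert
      fun_prop
    have hev := (hc t htX).eventually_ne hne
    rw [eventually_nhdsWithin_iff] at hev
    refine ht _ hev ?_
    have : ∀ᵐ s ∂νstar, ¬ (s ∈ X → dualCert X φ y κ νstar s ≠ 0) := by
      filter_upwards [h3, hae] with s hs hsX h
      exact h hsX hs
    simpa [ae_iff] using this
  · rintro ⟨h1, h2⟩ μ hμ hμX
    have hd := J_diff X φ y κ νstar μ hXcomp hφ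
    have g1 : 0 ≤ ∫ t in X, dualCert X φ y κ νstar t ∂μ := setIntegral_nonneg hXm h1
    have g2 : ∫ t in X, dualCert X φ y κ νstar t ∂νstar = 0 := by
      rw [Measure.restrict_eq_self_of_ae_mem hae]
      apply integral_eq_zero_of_ae
      have : νstar.support ∈ ae νstar := Measure.support_mem_ae
      filter_upwards [this] with t ht
      apply h2
      intro U hU
      exact ((Measure.mem_support_iff_forall _).1 ht U hU).ne'
    have : 0 ≤ (1 / 2) * ‖PhiOp X φ μ - PhiOp X φ νstar‖ ^ 2 := by positivity
    linarith

end
end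

section
/- Weight-update perturbation bound and deletion-set inclusion: let C_TV > 0, ν ∈ M₊(𝒳) with ‖ν‖_TV ≤ C_TV, α > 0, and let ν⁺ := W_{ν,α} ν. Set C_w := α(C_P + C_TV + κ) e^{α(C_P + C_TV + κ)} C_TV. Then (i) ‖J'_{ν⁺} − J'_ν‖_∞ ≤ C_w, and (ii) for every ε > 0, {t ∈ 𝒳 : J'_{ν⁺}(t) > −2α^{−1} log ε + C_w} ⊆ {t ∈ 𝒳 : J'_ν(t) > −2α^{−1} log ε}, so that e^{−α J'_ν(t)} < ε² on the former set. -/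
/-!
STATEMENT 7 (Weight-update perturbation bound and deletion-set inclusion):
For ν ∈ M₊(𝒳) with ‖ν‖_TV ≤ C_TV, α > 0 and ν⁺ := W_{ν,α}ν, with
C_w := α(C_P+C_TV+κ)e^{α(C_P+C_TV+κ)}C_TV, one has (i) ‖J′_{ν⁺} − J′_ν‖_∞ ≤ C_w on 𝒳,
and (ii) for every ε > 0, on the set {J′_{ν⁺} > −2α⁻¹log ε + C_w} one has
J′_ν > −2α⁻¹ log ε, hence e^{−αJ′_ν} < ε².
-/

open MeasureTheory Set
open scoped RealInnerProductSpace ENNReal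

noncomputable section

/-- Assumption (H_P): the observation is bounded by `CP`, the kernel
`K(s,t) = ⟨φ_s, φ_t⟩` is twice continuously differentiable (in its first variable) with
kernel values, gradient and Hessian uniformly bounded by `CP` on `𝒳 × 𝒳`, the kernel is
bounded below by `cP > 0` on `𝒳 × 𝒳` and normalized on the diagonal. -/
structure AssumptionHP {d : ℕ} {H : Type*} [NormedAddCommGroup H] [InnerProductSpace ℝ H]
    (X : Set (EuclideanSpace ℝ (Fin d))) (φ : EuclideanSpace ℝ (Fin d) → H)
    (y : H) (cP CP : ℝ) : Prop where
  cP_pos : 0 < cP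
  CP_pos : 0 < CP
  y_bdd : ‖y‖ ≤ CP
  K_smooth : ∀ t ∈ X, ContDiff ℝ 2 fun s : EuclideanSpace ℝ (Fin d) => (⟪φ s, φ t⟫ : ℝ)
  K_bdd : ∀ s ∈ X, ∀ t ∈ X, |(⟪φ s, φ t⟫ : ℝ)| ≤ CP
  K_grad_bdd : ∀ s ∈ X, ∀ t ∈ X,
    ‖fderiv ℝ (fun u : EuclideanSpace ℝ (Fin d) => (⟪φ u, φ t⟫ : ℝ)) s‖ ≤ CP
  K_hess_bdd : ∀ s ∈ X, ∀ t ∈ X,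
    ‖fderiv ℝ (fderiv ℝ (fun u : EuclideanSpace ℝ (Fin d) => (⟪φ u, φ t⟫ : ℝ))) s‖ ≤ CP
  K_lower : ∀ s ∈ X, ∀ t ∈ X, cP ≤ (⟪φ s, φ t⟫ : ℝ)
  K_norm_one : ∀ t ∈ X, (⟪φ t, φ t⟫ : ℝ) = 1

/-- The weight update `W_{ν,α} ν`: the measure with density `e^{−α J′_ν}` w.r.t. ν. -/
def wUpdate {d : ℕ} {H : Type*} [NormedAddCommGroup H] [InnerProductSpace ℝ H]
    (X : Set (EuclideanSpace ℝ (Fin d))) (φ : EuclideanSpace ℝ (Fin d) → H)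
    (y : H) (κ α : ℝ) (ν : Measure (EuclideanSpace ℝ (Fin d))) :
    Measure (EuclideanSpace ℝ (Fin d)) :=
  ν.withDensity fun t => ENNReal.ofReal (Real.exp (-(α * dualCert X φ y κ ν t)))

theorem abs_exp_sub_one_le_aux (u : ℝ) : |Real.exp u - 1| ≤ |u| * Real.exp |u| := by
  rcases le_total 0 u with h | h
  · have h1 : 1 ≤ Real.exp u := Real.one_le_exp h
    rw [abs_of_nonneg h, abs_of_nonneg (by linarith)]
    have h2 := Real.add_one_le_exp (-u)
    have h3 : Real.exp (-u) * Real.exp u = 1 := by rw [← Real.exp_add]; simp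
    nlinarith [Real.exp_pos u]
  · have h1 : Real.exp u ≤ 1 := Real.exp_le_one_iff.2 h
    rw [abs_of_nonpos h, abs_of_nonpos (by linarith)]
    have h2 := Real.add_one_le_exp u
    have h3 : 1 ≤ Real.exp (-u) := Real.one_le_exp (by linarith)
    nlinarith

theorem weight_update_perturbation
    {d : ℕ} {H : Type*} [NormedAddCommGroup H] [InnerProductSpace ℝ H] [CompleteSpace H]
    [TopologicalSpace.SeparableSpace H]
    (hd : 1 ≤ d)
    (X : Set (EuclideanSpace ℝ (Fin d))) (hXcomp : IsCompact X) (hXconv : Convex ℝ X)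
    (hXint : (interior X).Nonempty)
    (φ : EuclideanSpace ℝ (Fin d) → H) (hφ : ContinuousOn φ X)
    (y : H) (κ : ℝ) (hκ : 0 < κ) (cP CP : ℝ)
    (hHP : AssumptionHP X φ y cP CP)
    (CTV : ℝ) (hCTV : 0 < CTV)
    (ν : Measure (EuclideanSpace ℝ (Fin d))) (hνfin : IsFiniteMeasure ν) (hνsupp : ν Xᶜ = 0)
    (hνTV : (ν X).toReal ≤ CTV)
    (α : ℝ) (hα : 0 < α)
    (Cw : ℝ) (hCw : Cw = α * (CP + CTV + κ) * Real.exp (α * (CP + CTV + κ)) * CTV) :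
    (∀ t ∈ X,
        |dualCert X φ y κ (wUpdate X φ y κ α ν) t - dualCert X φ y κ ν t| ≤ Cw) ∧
      ∀ ε : ℝ, 0 < ε → ∀ t ∈ X,
        dualCert X φ y κ (wUpdate X φ y κ α ν) t > -(2 / α) * Real.log ε + Cw →
          dualCert X φ y κ ν t > -(2 / α) * Real.log ε ∧
            Real.exp (-(α * dualCert X φ y κ ν t)) < ε ^ 2 := by
  have hXm : MeasurableSet X := hXcomp.isClosed.measurableSet
  have hn : ∀ t ∈ X, ‖φ t‖ = 1 := by
    intro t ht
    have h := hHP.K_norm_one t ht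
    rw [real_inner_self_eq_norm_sq] at h
    nlinarith [norm_nonneg (φ t)]
  have hΦ : ‖PhiOp X φ ν‖ ≤ CTV := by
    have h := norm_setIntegral_le_of_norm_le_const (μ := ν) (s := X) (f := φ) (C := 1)
      (measure_lt_top ν X) (fun t ht => (hn t ht).le)
    rw [Measure.real, one_mul] at h
    exact h.trans hνTV
  have hin : ∀ t ∈ X, ∀ z : H, |(⟪φ t, z⟫ : ℝ)| ≤ ‖z‖ := by
    intro t ht z
    have h := abs_real_inner_le_norm (φ t) z
    rwa [hn t ht, one_mul] at h
  have hJ : ∀ t ∈ X, |dualCert X φ y κ ν t| ≤ CP + CTV + κ := by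
    intro t ht
    have h1 := hin t ht (PhiOp X φ ν - y)
    have h2 := norm_sub_le (PhiOp X φ ν) y
    have h3 := hHP.y_bdd
    unfold dualCert
    refine (abs_add_le _ _).trans ?_
    rw [abs_of_pos hκ]
    linarith
  set M := CP + CTV + κ with hM
  have hMpos : 0 < M := by have := hHP.CP_pos; positivity
  have hJc : ContinuousOn (fun t => Real.exp (-(α * dualCert X φ y κ ν t))) X := by
    unfold dualCert
    exact Real.continuous_exp.comp_continuousOn
      ((continuousOn_const.mul ((hφ.inner continuousOn_const).add continuousOn_const)).neg)
  have hΦ2 : PhiOp X φ (wUpdate X φ y κ α ν)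
      = ∫ t in X, Real.exp (-(α * dualCert X φ y κ ν t)) • φ t ∂ν := by
    rw [PhiOp, wUpdate, restrict_withDensity hXm,
      integral_withDensity_eq_integral_toReal_smul₀]
    · simp only [ENNReal.toReal_ofReal (Real.exp_pos _).le]
    · exact (hJc.aemeasurable hXm).ennreal_ofReal
    · exact Filter.Eventually.of_forall fun t => ENNReal.ofReal_lt_top
  have hint : IntegrableOn φ X ν := hφ.integrableOn_compact hXcomp
  have hint2 : IntegrableOn (fun t => Real.exp (-(α * dualCert X φ y κ ν t)) • φ t) X ν :=
    (hJc.smul hφ).integrableOn_compact hXcomp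
  have hdiff : ‖PhiOp X φ (wUpdate X φ y κ α ν) - PhiOp X φ ν‖ ≤ Cw := by
    rw [hΦ2, PhiOp, ← integral_sub hint2 hint]
    have h := norm_setIntegral_le_of_norm_le_const (μ := ν) (s := X)
      (f := fun t => Real.exp (-(α * dualCert X φ y κ ν t)) • φ t - φ t)
      (C := α * M * Real.exp (α * M)) (measure_lt_top ν X) (by
        intro t ht
        have e : Real.exp (-(α * dualCert X φ y κ ν t)) • φ t - φ t
          = (Real.exp (-(α * dualCert X φ y κ ν t)) - 1) • φ t := by rw [sub_smul, one_smul]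
        rw [e, norm_smul, hn t ht, mul_one, Real.norm_eq_abs]
        refine (abs_exp_sub_one_le_aux _).trans ?_
        have hb : |-(α * dualCert X φ y κ ν t)| ≤ α * M := by
          rw [abs_neg, abs_mul, abs_of_pos hα]
          exact mul_le_mul_of_nonneg_left (hJ t ht) hα.le
        gcongr)
    refine h.trans ?_
    rw [hCw, Measure.real]
    gcongr
  have hi : ∀ t ∈ X,
      |dualCert X φ y κ (wUpdate X φ y κ α ν) t - dualCert X φ y κ ν t| ≤ Cw := by
    intro t ht
    have e : dualCert X φ y κ (wUpdate X φ y κ α ν) t - dualCert X φ y κ ν t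
        = ⟪φ t, PhiOp X φ (wUpdate X φ y κ α ν) - PhiOp X φ ν⟫ := by
      simp only [dualCert, inner_sub_right]; ring
    rw [e]
    exact (hin t ht _).trans hdiff
  refine ⟨hi, fun ε hε t ht hgt => ?_⟩
  have h1 := (abs_le.1 (hi t ht)).2
  have h2 : dualCert X φ y κ ν t > -(2 / α) * Real.log ε := by linarith
  refine ⟨h2, ?_⟩
  have h3 : ε ^ 2 = Real.exp (2 * Real.log ε) := by
    rw [two_mul, Real.exp_add, Real.exp_log hε, sq]
  rw [h3, Real.exp_lt_exp]
  have h4 := mul_lt_mul_of_pos_left h2 hα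
  have h5 : α * (-(2 / α) * Real.log ε) = -(2 * Real.log ε) := by field_simp
  linarith

end
end

section
/- Uniform total-variation boundedness of the deterministic birth–death scheme: define ℜ := (‖y‖_ℍ/c_P)·e + √(e³ λ(𝒳)/c_P) + λ(𝒳) and set C_TV := ‖ν₀‖_TV ∨ 2ℜ. Let (ε_k)_{k≥0} satisfy 0 < ε_k ≤ α for all k and assume α ≤ 1/(1 + ℜ). Then the sequence (ν_k)_{k≥0} generated by the deterministic birth–death scheme from any ν₀ ∈ M₊(𝒳) satisfies ‖ν_k‖_TV ≤ ‖ν₀‖_TV ∨ 2ℜ for all k ≥ 0. -/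
/-!
STATEMENT 8 (Uniform total-variation boundedness of the deterministic birth–death
scheme): with ℜ := (‖y‖/c_P)e + √(e³λ(𝒳)/c_P) + λ(𝒳) and C_TV := ‖ν₀‖_TV ∨ 2ℜ, if
0 < ε_k ≤ α for all k and α ≤ 1/(1+ℜ), then ‖ν_k‖_TV ≤ ‖ν₀‖_TV ∨ 2ℜ for all k ≥ 0.
-/

open MeasureTheory Set
open scoped RealInnerProductSpace ENNReal

noncomputable section

/-- The deletion (death) region `P_{ν⁺} = {J′_{ν⁺} > −2α⁻¹ log ε + C_w} ∩ {J′_{ν⁺} > 0}`. -/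
def Pset {d : ℕ} {H : Type*} [NormedAddCommGroup H] [InnerProductSpace ℝ H]
    (X : Set (EuclideanSpace ℝ (Fin d))) (φ : EuclideanSpace ℝ (Fin d) → H)
    (y : H) (κ α εk Cw : ℝ) (νp : Measure (EuclideanSpace ℝ (Fin d))) :
    Set (EuclideanSpace ℝ (Fin d)) :=
  {t | dualCert X φ y κ νp t > -(2 / α) * Real.log εk + Cw ∧ 0 < dualCert X φ y κ νp t}

/-- The birth region `N_{ν⁺} = {t ∈ 𝒳 : J′_{ν⁺}(t) ≤ 0}`. -/
def Nset {d : ℕ} {H : Type*} [NormedAddCommGroup H] [InnerProductSpace ℝ H]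
    (X : Set (EuclideanSpace ℝ (Fin d))) (φ : EuclideanSpace ℝ (Fin d) → H)
    (y : H) (κ : ℝ) (νp : Measure (EuclideanSpace ℝ (Fin d))) :
    Set (EuclideanSpace ℝ (Fin d)) :=
  {t ∈ X | dualCert X φ y κ νp t ≤ 0}

/-- One step of the deterministic birth–death scheme:
`ν_{k+1} := (1 − 1_{P_{ν_{k⁺}}})·ν_{k⁺} + ε_k 1_{N_{ν_{k⁺}}}·λ` where `ν_{k⁺} = W_{ν_k,α}ν_k`. -/
def bdStep {d : ℕ} {H : Type*} [NormedAddCommGroup H] [InnerProductSpace ℝ H]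
    (X : Set (EuclideanSpace ℝ (Fin d))) (φ : EuclideanSpace ℝ (Fin d) → H)
    (y : H) (κ α εk Cw : ℝ) (ν : Measure (EuclideanSpace ℝ (Fin d))) :
    Measure (EuclideanSpace ℝ (Fin d)) :=
  (wUpdate X φ y κ α ν).restrict (Pset X φ y κ α εk Cw (wUpdate X φ y κ α ν))ᶜ
    + (ENNReal.ofReal εk) • volume.restrict (Nset X φ y κ (wUpdate X φ y κ α ν))

theorem dualCert_lower {d : ℕ} {H : Type*} [NormedAddCommGroup H] [InnerProductSpace ℝ H]
    [CompleteSpace H] (X : Set (EuclideanSpace ℝ (Fin d))) (hX : IsCompact X)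
    (φ : EuclideanSpace ℝ (Fin d) → H) (hφ : ContinuousOn φ X) (y : H) (κ cP CP : ℝ)
    (hHP : AssumptionHP X φ y cP CP) (μ : Measure (EuclideanSpace ℝ (Fin d)))
    [IsFiniteMeasure μ] (t : EuclideanSpace ℝ (Fin d)) (ht : t ∈ X) :
    cP * (μ X).toReal - ‖y‖ + κ ≤ dualCert X φ y κ μ t := by
  unfold dualCert PhiOp
  have hint : IntegrableOn φ X μ := hφ.integrableOn_compact hX
  have h1 : (⟪φ t, ∫ s in X, φ s ∂μ⟫ : ℝ) = ∫ s in X, (⟪φ t, φ s⟫ : ℝ) ∂μ :=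
    (integral_inner hint (φ t)).symm
  have h2 : cP * (μ X).toReal ≤ ∫ s in X, (⟪φ t, φ s⟫ : ℝ) ∂μ := by
    have h := setIntegral_mono_on (μ := μ) (s := X) (f := fun _ => cP)
      (g := fun s => (⟪φ t, φ s⟫ : ℝ)) (integrable_const _)
      (Integrable.const_inner (φ t) hint) hX.measurableSet
      (fun s hs => hHP.K_lower t ht s hs)
    have h' : ∫ _ in X, cP ∂μ = cP * (μ X).toReal := by
      simp [Measure.real, mul_comm]
    linarith
  have h3 : ‖φ t‖ = 1 := by
    have := hHP.K_norm_one t ht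
    rw [real_inner_self_eq_norm_sq] at this
    nlinarith [norm_nonneg (φ t)]
  have h4 := real_inner_le_norm (φ t) y
  rw [h3, one_mul] at h4
  rw [inner_sub_right, h1]
  linarith

theorem step_bound {d : ℕ} {H : Type*} [NormedAddCommGroup H] [InnerProductSpace ℝ H]
    [CompleteSpace H] (X : Set (EuclideanSpace ℝ (Fin d))) (hX : IsCompact X)
    (hne : X.Nonempty)
    (φ : EuclideanSpace ℝ (Fin d) → H) (hφ : ContinuousOn φ X) (y : H) (κ : ℝ) (hκ : 0 < κ)
    (cP CP : ℝ) (hHP : AssumptionHP X φ y cP CP) (μ : Measure (EuclideanSpace ℝ (Fin d)))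
    [IsFiniteMeasure μ] (hs : μ Xᶜ = 0) (α e Cw R : ℝ) (hα : 0 < α) (he : e ≤ α) (h1 : α ≤ 1)
    (hy : α * ‖y‖ ≤ 1) (hR1 : ‖y‖ / cP * Real.exp 1 ≤ R)
    (hR2 : ‖y‖ / cP + (volume X).toReal ≤ R) :
    IsFiniteMeasure (bdStep X φ y κ α e Cw μ) ∧ bdStep X φ y κ α e Cw μ Xᶜ = 0 ∧
      bdStep X φ y κ α e Cw μ X ≤ max (μ X) (ENNReal.ofReal R) := by
  have hc := hHP.cP_pos
  set m := (μ X).toReal with hm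
  have hm0 : 0 ≤ m := ENNReal.toReal_nonneg
  have hμX : μ X = ENNReal.ofReal m := (ENNReal.ofReal_toReal (measure_ne_top μ X)).symm
  set w := wUpdate X φ y κ α μ with hw
  have hwc : w Xᶜ = 0 := withDensity_absolutelyContinuous _ _ hs
  have hwX : w X ≤ ENNReal.ofReal (m * Real.exp (-(α * (cP * m - ‖y‖ + κ)))) := by
    rw [hw, wUpdate, withDensity_apply _ hX.measurableSet]
    calc _ ≤ ∫⁻ _ in X, ENNReal.ofReal (Real.exp (-(α * (cP * m - ‖y‖ + κ)))) ∂μ := by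
          refine setLIntegral_mono' hX.measurableSet fun t ht => ?_
          refine ENNReal.ofReal_le_ofReal (Real.exp_le_exp.2 ?_)
          have := dualCert_lower X hX φ hφ y κ cP CP hHP μ t ht
          exact neg_le_neg (mul_le_mul_of_nonneg_left this hα.le)
      _ = _ := by
          rw [setLIntegral_const, hμX, mul_comm, ENNReal.ofReal_mul hm0]
  have hwfin : IsFiniteMeasure w := by
    refine ⟨?_⟩
    rw [← measure_add_measure_compl hX.measurableSet, hwc, add_zero]
    exact lt_of_le_of_lt hwX ENNReal.ofReal_lt_top
  set N := Nset X φ y κ w with hN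
  have hNX : N ⊆ X := fun t ht => ht.1
  have hb : bdStep X φ y κ α e Cw μ = w.restrict (Pset X φ y κ α e Cw w)ᶜ
    + (ENNReal.ofReal e) • volume.restrict N := rfl
  rw [hb]
  have hcompl : (w.restrict (Pset X φ y κ α e Cw w)ᶜ
    + (ENNReal.ofReal e) • volume.restrict N) Xᶜ = 0 := by
    have ha : w.restrict (Pset X φ y κ α e Cw w)ᶜ Xᶜ = 0 :=
      le_antisymm ((Measure.restrict_le_self _).trans hwc.le) bot_le
    have hb : (volume.restrict N) Xᶜ = 0 := by
      rw [Measure.restrict_apply hX.measurableSet.compl]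
      have : Xᶜ ∩ N = ∅ := by
        ext t; simp only [mem_inter_iff, mem_compl_iff, mem_empty_iff_false, iff_false]
        exact fun h => h.1 (hNX h.2)
      rw [this, measure_empty]
    simp [ha, hb]
  have hmain : (w.restrict (Pset X φ y κ α e Cw w)ᶜ
    + (ENNReal.ofReal e) • volume.restrict N) X ≤ max (μ X) (ENNReal.ofReal R) := by
    have ha : w.restrict (Pset X φ y κ α e Cw w)ᶜ X ≤ w X := Measure.restrict_le_self _
    have hy0 : 0 ≤ ‖y‖ / cP := by positivity
    rcases N.eq_empty_or_nonempty with h0 | ⟨t, ht⟩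
    · rw [h0]
      simp only [Measure.restrict_empty, smul_zero, add_zero]
      refine ha.trans (hwX.trans ?_)
      by_cases hcm : ‖y‖ ≤ cP * m
      · refine le_max_of_le_left ?_
        rw [hμX]
        refine ENNReal.ofReal_le_ofReal ?_
        have : Real.exp (-(α * (cP * m - ‖y‖ + κ))) ≤ 1 := by
          rw [Real.exp_le_one_iff]
          have : 0 ≤ α * (cP * m - ‖y‖ + κ) := mul_nonneg hα.le (by linarith)
          linarith
        nlinarith
      · refine le_max_of_le_right (ENNReal.ofReal_le_ofReal (le_trans ?_ hR1))
        have hmy : m ≤ ‖y‖ / cP := by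
          rw [le_div_iff₀ hc]; nlinarith
        have : Real.exp (-(α * (cP * m - ‖y‖ + κ))) ≤ Real.exp 1 := by
          rw [Real.exp_le_exp]
          have : 0 ≤ α * (cP * m + κ) := by positivity
          nlinarith
        exact mul_le_mul hmy this (Real.exp_pos _).le hy0
    · refine le_max_of_le_right ?_
      have h := dualCert_lower X hX φ hφ y κ cP CP hHP w t ht.1
      have h' : dualCert X φ y κ w t ≤ 0 := ht.2
      have hwy : (w X).toReal ≤ ‖y‖ / cP := by
        rw [le_div_iff₀ hc]; nlinarith
      have hwy' : w X ≤ ENNReal.ofReal (‖y‖ / cP) := by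
        rw [← ENNReal.ofReal_toReal (measure_ne_top w X)]
        exact ENNReal.ofReal_le_ofReal hwy
      have hv : (volume.restrict N) X ≤ ENNReal.ofReal (volume X).toReal := by
        rw [ENNReal.ofReal_toReal hX.measure_lt_top.ne]
        exact Measure.restrict_le_self _
      have he1 : ENNReal.ofReal e ≤ 1 := by
        rw [← ENNReal.ofReal_one]; exact ENNReal.ofReal_le_ofReal (he.trans h1)
      calc _ = w.restrict (Pset X φ y κ α e Cw w)ᶜ X
              + (ENNReal.ofReal e) * (volume.restrict N) X := by simp
        _ ≤ ENNReal.ofReal (‖y‖ / cP) + 1 * ENNReal.ofReal (volume X).toReal :=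
            add_le_add (ha.trans hwy') (mul_le_mul' he1 hv)
        _ = ENNReal.ofReal (‖y‖ / cP + (volume X).toReal) := by
            rw [one_mul, ENNReal.ofReal_add hy0 ENNReal.toReal_nonneg]
        _ ≤ _ := ENNReal.ofReal_le_ofReal hR2
  refine ⟨⟨?_⟩, hcompl, hmain⟩
  rw [← measure_add_measure_compl hX.measurableSet, hcompl, add_zero]
  exact lt_of_le_of_lt hmain (max_lt (measure_lt_top μ X) ENNReal.ofReal_lt_top)

theorem tv_bounded_deterministic_scheme
    {d : ℕ} {H : Type*} [NormedAddCommGroup H] [InnerProductSpace ℝ H] [CompleteSpace H]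
    [TopologicalSpace.SeparableSpace H]
    (hd : 1 ≤ d)
    (X : Set (EuclideanSpace ℝ (Fin d))) (hXcomp : IsCompact X) (hXconv : Convex ℝ X)
    (hXint : (interior X).Nonempty)
    (φ : EuclideanSpace ℝ (Fin d) → H) (hφ : ContinuousOn φ X)
    (y : H) (κ : ℝ) (hκ : 0 < κ) (cP CP : ℝ)
    (hHP : AssumptionHP X φ y cP CP)
    (ν : ℕ → Measure (EuclideanSpace ℝ (Fin d)))
    (hfin0 : IsFiniteMeasure (ν 0)) (hsupp0 : ν 0 Xᶜ = 0)
    (α : ℝ) (hα0 : 0 < α)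
    (R : ℝ) (hR : R = ‖y‖ / cP * Real.exp 1
      + Real.sqrt (Real.exp 3 * (volume X).toReal / cP) + (volume X).toReal)
    (CTV : ℝ) (hCTVdef : CTV = max ((ν 0) X).toReal (2 * R))
    (Cw : ℝ) (hCw : Cw = α * (CP + CTV + κ) * Real.exp (α * (CP + CTV + κ)) * CTV)
    (ε : ℕ → ℝ) (hε : ∀ k, 0 < ε k ∧ ε k ≤ α)
    (hαR : α ≤ 1 / (1 + R))
    (hrec : ∀ k, ν (k + 1) = bdStep X φ y κ α (ε k) Cw (ν k)) :
    ∀ k, ν k X ≤ ENNReal.ofReal (max ((ν 0) X).toReal (2 * R)) := by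
  have hne : X.Nonempty := hXint.mono interior_subset
  have hc := hHP.cP_pos
  have hc1 : cP ≤ 1 := by
    obtain ⟨t, ht⟩ := hne
    have h1 := hHP.K_lower t ht t ht
    rw [hHP.K_norm_one t ht] at h1
    exact h1
  have hv0 : 0 ≤ (volume X).toReal := ENNReal.toReal_nonneg
  have hs0 := Real.sqrt_nonneg (Real.exp 3 * (volume X).toReal / cP)
  have hy0 : 0 ≤ ‖y‖ / cP := by positivity
  have he : 1 ≤ Real.exp 1 := Real.one_le_exp (by norm_num)
  have hyc : ‖y‖ ≤ ‖y‖ / cP := le_div_self (norm_nonneg y) hc hc1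
  have hye : ‖y‖ / cP ≤ ‖y‖ / cP * Real.exp 1 := le_mul_of_one_le_right hy0 he
  have hR0 : 0 ≤ R := by linarith
  have hα' : α * (1 + R) ≤ 1 := by rwa [le_div_iff₀ (by linarith)] at hαR
  have hα1 : α ≤ 1 := by nlinarith
  have hαy : α * ‖y‖ ≤ 1 := by
    have : α * ‖y‖ ≤ α * (1 + R) := mul_le_mul_of_nonneg_left (by linarith) hα0.le
    linarith
  have key : ∀ k, IsFiniteMeasure (ν k) ∧ ν k Xᶜ = 0 ∧
      ν k X ≤ ENNReal.ofReal (max ((ν 0) X).toReal (2 * R)) := by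
    intro k
    induction k with
    | zero =>
      refine ⟨hfin0, hsupp0, ?_⟩
      refine le_trans ?_ (ENNReal.ofReal_le_ofReal (le_max_left _ _))
      rw [ENNReal.ofReal_toReal (measure_ne_top _ _)]
    | succ k ih =>
      obtain ⟨i1, i2, i3⟩ := ih
      obtain ⟨j1, j2, j3⟩ := step_bound X hXcomp hne φ hφ y κ hκ cP CP hHP (ν k) i2 α (ε k) Cw R
        hα0 (hε k).2 hα1 hαy (by linarith) (by linarith)
      rw [hrec k]
      refine ⟨j1, j2, j3.trans (max_le i3 (ENNReal.ofReal_le_ofReal ?_))⟩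
      exact le_max_of_le_right (by linarith)
  exact fun k => (key k).2.2

end
end

section
/- Energy smoothness of the birth–death transition: let C_TV > 0, α > 0, ε_k > 0, and let ν_k ∈ M₊(𝒳) with ‖ν_k‖_TV ≤ C_TV. Let ν_{k⁺} and ν_{k+1} be produced by one step of the deterministic birth–death scheme. Then J(ν_{k+1}) − J(ν_{k⁺}) ≤ ‖ν_k‖_TV² · ε_k⁴ + λ(𝒳)² · ε_k². -/
/-!
STATEMENT 9 (Energy smoothness of the birth–death transition):
For ν_k ∈ M₊(𝒳) with ‖ν_k‖_TV ≤ C_TV, one step of the deterministic birth–death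
scheme satisfies J(ν_{k+1}) − J(ν_{k⁺}) ≤ ‖ν_k‖_TV²·ε_k⁴ + λ(𝒳)²·ε_k².
-/

open MeasureTheory Set
open scoped RealInnerProductSpace ENNReal

noncomputable section

theorem energy_smoothness_birth_death
    {d : ℕ} {H : Type*} [NormedAddCommGroup H] [InnerProductSpace ℝ H] [CompleteSpace H]
    [TopologicalSpace.SeparableSpace H]
    (hd : 1 ≤ d)
    (X : Set (EuclideanSpace ℝ (Fin d))) (hXcomp : IsCompact X) (hXconv : Convex ℝ X)
    (hXint : (interior X).Nonempty)
    (φ : EuclideanSpace ℝ (Fin d) → H) (hφ : ContinuousOn φ X)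
    (y : H) (κ : ℝ) (hκ : 0 < κ) (cP CP : ℝ)
    (hHP : AssumptionHP X φ y cP CP)
    (CTV : ℝ) (hCTV : 0 < CTV)
    (νk : Measure (EuclideanSpace ℝ (Fin d))) (hfin : IsFiniteMeasure νk)
    (hsupp : νk Xᶜ = 0) (hTV : (νk X).toReal ≤ CTV)
    (α εk : ℝ) (hα : 0 < α) (hεk : 0 < εk)
    (Cw : ℝ) (hCw : Cw = α * (CP + CTV + κ) * Real.exp (α * (CP + CTV + κ)) * CTV) :
    Jobj X φ y κ (bdStep X φ y κ α εk Cw νk) - Jobj X φ y κ (wUpdate X φ y κ α νk)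
      ≤ ((νk X).toReal) ^ 2 * εk ^ 4 + ((volume X).toReal) ^ 2 * εk ^ 2 := by
  have hXm : MeasurableSet X := hXcomp.isClosed.measurableSet
  have hnorm : ∀ t ∈ X, ‖φ t‖ = 1 := by
    intro t ht
    have h := hHP.K_norm_one t ht
    rw [real_inner_self_eq_norm_sq] at h
    nlinarith [norm_nonneg (φ t)]
  have hDcont : ∀ ν, ContinuousOn (dualCert X φ y κ ν) X := by
    intro ν
    unfold dualCert
    exact (hφ.inner continuousOn_const).add continuousOn_const
  have hmem : ∀ᵐ t ∂νk, t ∈ X := by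
    rw [ae_iff]; exact hsupp
  have hres : νk.restrict X = νk := Measure.restrict_eq_self_of_ae_mem hmem
  have hsn : ∀ μ : Measure (EuclideanSpace ℝ (Fin d)), IsFiniteMeasure μ → ∀ S ⊆ X,
      MeasurableSet S → ‖∫ t in S, φ t ∂μ‖ ≤ (μ S).toReal := by
    intro μ hμ S hS hSm
    have := norm_setIntegral_le_of_norm_le_const (μ := μ) (s := S) (f := φ) (C := 1)
      (measure_lt_top _ _) (fun t ht => (hnorm t (hS ht)).le)
    simpa [Measure.real] using this
  set M := CP + CTV + κ with hM
  have hM0 : 0 < M := by have := hHP.CP_pos; positivity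
  set J := dualCert X φ y κ νk with hJ
  have hJb : ∀ t ∈ X, |J t| ≤ M := by
    intro t ht
    have h1 := abs_real_inner_le_norm (φ t) (PhiOp X φ νk - y)
    rw [hnorm t ht, one_mul] at h1
    have h2 := norm_sub_le (PhiOp X φ νk) y
    have h3 : ‖PhiOp X φ νk‖ ≤ (νk X).toReal := hsn νk hfin X subset_rfl hXm
    have h4 := hHP.y_bdd
    have h5 := abs_add_le (⟪φ t, PhiOp X φ νk - y⟫ : ℝ) κ
    rw [abs_of_pos hκ] at h5
    have : J t = (⟪φ t, PhiOp X φ νk - y⟫ : ℝ) + κ := rfl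
    rw [this]; linarith
  have hJae : AEMeasurable J νk := by
    have := (hDcont νk).aemeasurable (μ := νk) hXm
    rwa [hres] at this
  have hwae : AEMeasurable (fun t => Real.exp (-(α * J t))) νk :=
    Real.measurable_exp.comp_aemeasurable (hJae.const_mul α).neg
  set νp := wUpdate X φ y κ α νk with hνp
  have hνp' : νp = νk.withDensity fun t => ENNReal.ofReal (Real.exp (-(α * J t))) := rfl
  have hpsupp : ∀ᵐ t ∂νp, t ∈ X := (withDensity_absolutelyContinuous νk _).ae_le hmem
  have hpres : νp.restrict X = νp := Measure.restrict_eq_self_of_ae_mem hpsupp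
  have hpfin : IsFiniteMeasure νp := by
    rw [hνp']
    refine isFiniteMeasure_withDensity_ofReal ?_
    refine HasFiniteIntegral.of_bounded (C := Real.exp (α * M)) ?_
    filter_upwards [hmem] with t ht
    rw [Real.norm_eq_abs, abs_of_pos (Real.exp_pos _), Real.exp_le_exp]
    have := (abs_le.1 (hJb t ht)).1
    nlinarith
  have hexp : ∀ x B : ℝ, |x| ≤ B → |Real.exp x - 1| ≤ B * Real.exp B := by
    intro x B hx
    have hB : 0 ≤ B := (abs_nonneg x).trans hx
    have e1 := Real.add_one_le_exp x
    have e2 := Real.add_one_le_exp (-x)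
    have e3 : Real.exp x ≤ Real.exp B := Real.exp_le_exp.2 ((le_abs_self x).trans hx)
    have e4 : Real.exp x * Real.exp (-x) = 1 := by rw [← Real.exp_add]; simp
    have e5 : 1 ≤ Real.exp B := Real.one_le_exp hB
    have e6 := Real.exp_pos x
    obtain ⟨h1, h2⟩ := abs_le.1 hx
    rw [abs_le]
    constructor
    · nlinarith
    · nlinarith
  have hdiff : ‖PhiOp X φ νp - PhiOp X φ νk‖ ≤ Cw := by
    have hpi : PhiOp X φ νp = ∫ t, Real.exp (-(α * J t)) • φ t ∂νk := by
      unfold PhiOp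
      rw [hpres, hνp', integral_withDensity_eq_integral_toReal_smul₀ hwae.ennreal_ofReal
        (by simp)]
      refine integral_congr_ae (Filter.Eventually.of_forall fun t => ?_)
      simp only
      rw [ENNReal.toReal_ofReal (Real.exp_pos _).le]
    have hki : PhiOp X φ νk = ∫ t, φ t ∂νk := by
      unfold PhiOp; rw [hres]
    have i1 : Integrable φ νk := by
      have := hφ.integrableOn_compact (μ := νk) hXcomp
      rwa [IntegrableOn, hres] at this
    have i2 : Integrable (fun t => Real.exp (-(α * J t)) • φ t) νk := by
      have h : ContinuousOn (fun t => Real.exp (-(α * J t)) • φ t) X :=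
        (Real.continuous_exp.comp_continuousOn
          ((continuousOn_const.mul (hDcont νk)).neg)).smul hφ
      have := h.integrableOn_compact (μ := νk) hXcomp
      rwa [IntegrableOn, hres] at this
    rw [hpi, hki, ← integral_sub i2 i1]
    have hb : ∀ᵐ t ∂νk, ‖Real.exp (-(α * J t)) • φ t - φ t‖ ≤ (α * M) * Real.exp (α * M) := by
      filter_upwards [hmem] with t ht
      have : Real.exp (-(α * J t)) • φ t - φ t = (Real.exp (-(α * J t)) - 1) • φ t := by
        rw [sub_smul, one_smul]
      rw [this, norm_smul, hnorm t ht, mul_one, Real.norm_eq_abs]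
      apply hexp
      rw [abs_neg, abs_mul, abs_of_pos hα]
      exact mul_le_mul_of_nonneg_left (hJb t ht) hα.le
    have h1 := norm_integral_le_of_norm_le_const hb
    have h2 : νk.real univ ≤ CTV := by
      rw [← hres, Measure.real, Measure.restrict_apply_univ]; exact hTV
    refine h1.trans ?_
    rw [hCw]
    exact mul_le_mul_of_nonneg_left h2 (by positivity)
  set D := dualCert X φ y κ νp with hD
  have hDae : Measurable (X.indicator D) := by
    classical
    have := (hDcont νp).measurable_piecewise (g := fun _ => (0:ℝ)) continuousOn_const hXm
    rwa [← Set.piecewise_eq_indicator]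
  set P := Pset X φ y κ α εk Cw νp with hP
  set N := Nset X φ y κ νp with hN
  have hPm : MeasurableSet (P ∩ X) := by
    have : P ∩ X = X ∩ {t | X.indicator D t > -(2 / α) * Real.log εk + Cw ∧
        0 < X.indicator D t} := by
      ext t
      by_cases ht : t ∈ X
      · simp [ht, hP, Pset, ← hD]
      · simp [ht]
    rw [this]
    exact hXm.inter ((measurableSet_lt measurable_const hDae).inter
      (measurableSet_lt measurable_const hDae))
  have hNm : MeasurableSet N := by
    have : N = X ∩ {t | X.indicator D t ≤ 0} := by
      ext t
      by_cases ht : t ∈ X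
      · simp [ht, hN, Nset, ← hD]
      · simp [ht, hN, Nset]
    rw [this]
    exact hXm.inter (measurableSet_le hDae measurable_const)
  have hNX : N ⊆ X := fun t ht => ht.1
  have hbd : bdStep X φ y κ α εk Cw νk =
      νp.restrict (P ∩ X)ᶜ + (ENNReal.ofReal εk) • volume.restrict N := by
    unfold bdStep
    congr 1
    apply Measure.restrict_congr_set
    filter_upwards [hpsupp] with t ht
    apply propext
    change t ∈ Pᶜ ↔ t ∈ (P ∩ X)ᶜ
    simp [ht]
  have hvX : volume X < ⊤ := hXcomp.measure_lt_top
  have hvN : volume N ≤ volume X := measure_mono hNX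
  have iν : Integrable φ νp := by
    have := hφ.integrableOn_compact (μ := νp) hXcomp
    rwa [IntegrableOn, hpres] at this
  have iN : IntegrableOn φ N volume := (hφ.integrableOn_compact hXcomp).mono_set hNX
  set a := ∫ t in P ∩ X, φ t ∂νp with ha
  set b := ∫ t in N, φ t with hb
  have hbX : (bdStep X φ y κ α εk Cw νk).restrict X =
      νp.restrict (P ∩ X)ᶜ + (ENNReal.ofReal εk) • volume.restrict N := by
    rw [hbd, Measure.restrict_add, Measure.restrict_smul, Measure.restrict_restrict hXm,
      Measure.restrict_restrict hXm, Set.inter_eq_right.2 hNX, Set.inter_comm X,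
      ← Measure.restrict_restrict hPm.compl, hpres]
  have hΦ : PhiOp X φ (bdStep X φ y κ α εk Cw νk) = PhiOp X φ νp - a + εk • b := by
    unfold PhiOp
    rw [hbX, integral_add_measure iν.integrableOn
      (Integrable.smul_measure iN ENNReal.ofReal_ne_top), integral_smul_measure, hpres,
      ENNReal.toReal_ofReal hεk.le, ← integral_add_compl hPm iν]
    simp [ha, hb]
  have hmass : ((bdStep X φ y κ α εk Cw νk) X).toReal =
      (νp X).toReal - (νp (P ∩ X)).toReal + εk * (volume N).toReal := by
    have h1 : (bdStep X φ y κ α εk Cw νk) X = νp (P ∩ X)ᶜ + ENNReal.ofReal εk * volume N := by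
      rw [← Measure.restrict_apply_univ, hbX]
      simp
    have h2 : νp X = νp univ := by
      rw [← Measure.restrict_apply_univ, hpres]
    rw [h1, ENNReal.toReal_add (measure_ne_top _ _)
      (ENNReal.mul_ne_top ENNReal.ofReal_ne_top (hvN.trans_lt hvX).ne), ENNReal.toReal_mul,
      ENNReal.toReal_ofReal hεk.le, h2, measure_compl hPm (measure_ne_top _ _),
      ENNReal.toReal_sub_of_le (measure_mono (subset_univ _)) (measure_ne_top _ _)]
  set z := PhiOp X φ νp - y with hz
  have hlin : ∀ (μ : Measure (EuclideanSpace ℝ (Fin d))) (S : Set _), μ S < ⊤ →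
      IntegrableOn φ S μ →
      ∫ t in S, D t ∂μ = (⟪∫ t in S, φ t ∂μ, z⟫ : ℝ) + κ * (μ S).toReal := by
    intro μ S hS hi
    have : IsFiniteMeasure (μ.restrict S) := ⟨by simpa using hS⟩
    have hDe : ∀ t, D t = (⟪z, φ t⟫ : ℝ) + κ := by
      intro t
      rw [real_inner_comm]; rfl
    simp_rw [hDe]
    rw [integral_add (hi.const_inner z) (integrable_const _), integral_inner hi,
      real_inner_comm]
    simp [Measure.real, mul_comm]
  have hLa := hlin νp (P ∩ X) (measure_lt_top _ _) iν.integrableOn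
  have hLb := hlin volume N (hvN.trans_lt hvX) iN
  have hLa0 : 0 ≤ ∫ t in P ∩ X, D t ∂νp :=
    setIntegral_nonneg hPm fun t ht => ht.1.2.le
  have hLb0 : ∫ t in N, D t ≤ 0 :=
    setIntegral_nonpos hNm fun t ht => ht.2
  have hna : ‖a‖ ≤ (νp (P ∩ X)).toReal := hsn νp hpfin _ inter_subset_right hPm
  have hnb : ‖b‖ ≤ (volume X).toReal := by
    have := norm_setIntegral_le_of_norm_le_const (μ := volume) (s := N) (f := φ) (C := 1)
      (hvN.trans_lt hvX) (fun t ht => (hnorm t (hNX ht)).le)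
    rw [one_mul] at this
    exact this.trans (ENNReal.toReal_mono hvX.ne hvN)
  have hmP : (νp (P ∩ X)).toReal ≤ (νk X).toReal * εk ^ 2 := by
    have hpt : ∀ t ∈ P ∩ X, Real.exp (-(α * J t)) ≤ εk ^ 2 := by
      rintro t ⟨⟨h1, -⟩, ht⟩
      have h2 : D t - J t ≤ Cw := by
        have e : D t - J t = (⟪φ t, PhiOp X φ νp - PhiOp X φ νk⟫ : ℝ) := by
          simp only [hD, hJ, dualCert, inner_sub_right]; ring
        rw [e]
        refine (real_inner_le_norm _ _).trans ?_
        rw [hnorm t ht, one_mul]; exact hdiff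
      have h3 : -(2 / α) * Real.log εk < J t := by
        change D t > _ at h1
        linarith
      have h4 : -(α * J t) ≤ 2 * Real.log εk := by
        have := mul_lt_mul_of_pos_left h3 hα
        have e : α * (-(2 / α) * Real.log εk) = -(2 * Real.log εk) := by field_simp
        linarith
      calc Real.exp (-(α * J t)) ≤ Real.exp (2 * Real.log εk) := Real.exp_le_exp.2 h4
        _ = εk ^ 2 := by
          rw [two_mul, Real.exp_add, Real.exp_log hεk]; ring
    have h5 : νp (P ∩ X) ≤ ENNReal.ofReal (εk ^ 2) * νk X := by
      rw [hνp', withDensity_apply _ hPm]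
      calc _ ≤ ∫⁻ t in P ∩ X, ENNReal.ofReal (εk ^ 2) ∂νk :=
            setLIntegral_mono' hPm fun t ht => ENNReal.ofReal_le_ofReal (hpt t ht)
        _ = ENNReal.ofReal (εk ^ 2) * νk (P ∩ X) := setLIntegral_const _ _
        _ ≤ _ := by gcongr; exact inter_subset_right
    have h6 := ENNReal.toReal_mono
      (ENNReal.mul_ne_top ENNReal.ofReal_ne_top (measure_ne_top _ _)) h5
    rw [ENNReal.toReal_mul, ENNReal.toReal_ofReal (by positivity)] at h6
    linarith
  have hw : ‖εk • b - a‖ ≤ (νk X).toReal * εk ^ 2 + εk * (volume X).toReal := by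
    refine (norm_sub_le _ _).trans ?_
    rw [norm_smul, Real.norm_eq_abs, abs_of_pos hεk]
    have := mul_le_mul_of_nonneg_left hnb hεk.le
    linarith
  have hsq : ‖y - PhiOp X φ (bdStep X φ y κ α εk Cw νk)‖ ^ 2 =
      ‖y - PhiOp X φ νp‖ ^ 2 + 2 * (εk * (⟪b, z⟫ : ℝ) - ⟪a, z⟫) + ‖εk • b - a‖ ^ 2 := by
    have e1 : y - PhiOp X φ (bdStep X φ y κ α εk Cw νk) = -((εk • b - a) + z) := by
      rw [hΦ, hz]; abel
    have e2 : y - PhiOp X φ νp = - z := by rw [hz]; abel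
    rw [e1, e2, norm_neg, norm_neg, norm_add_sq_real, inner_sub_left, inner_smul_left]
    simp only [conj_trivial]
    ring
  have hw2 := pow_le_pow_left₀ (norm_nonneg _) hw 2
  have hbb : εk * ((⟪b, z⟫ : ℝ) + κ * (volume N).toReal) ≤ 0 := by
    rw [← hLb]; exact mul_nonpos_of_nonneg_of_nonpos hεk.le hLb0
  rw [hLa] at hLa0
  unfold Jobj
  rw [hsq, hmass]
  nlinarith [sq_nonneg ((νk X).toReal * εk ^ 2 - εk * (volume X).toReal)]


end
end

section
/- Certificate smoothness of the birth–death transition: let C_TV > 0, α > 0, ε_k > 0, and let ν_k ∈ M₊(𝒳) with ‖ν_k‖_TV ≤ C_TV. Let ν_{k⁺} and ν_{k+1} be produced by one step of the deterministic birth–death scheme. Then sup_{t∈𝒳} |J'_{ν_{k+1}}(t) − J'_{ν_{k⁺}}(t)| ≤ ‖ν_k‖_TV · ε_k² + λ(𝒳) · ε_k. -/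
/-!
STATEMENT 10 (Certificate smoothness of the birth–death transition):
For ν_k ∈ M₊(𝒳) with ‖ν_k‖_TV ≤ C_TV, one step of the deterministic birth–death
scheme satisfies sup_{t∈𝒳} |J′_{ν_{k+1}}(t) − J′_{ν_{k⁺}}(t)| ≤ ‖ν_k‖_TV·ε_k² + λ(𝒳)·ε_k.
-/

open MeasureTheory Set
open scoped RealInnerProductSpace ENNReal

noncomputable section

theorem certificate_smoothness_birth_death
    {d : ℕ} {H : Type*} [NormedAddCommGroup H] [InnerProductSpace ℝ H] [CompleteSpace H]
    [TopologicalSpace.SeparableSpace H]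
    (hd : 1 ≤ d)
    (X : Set (EuclideanSpace ℝ (Fin d))) (hXcomp : IsCompact X) (hXconv : Convex ℝ X)
    (hXint : (interior X).Nonempty)
    (φ : EuclideanSpace ℝ (Fin d) → H) (hφ : ContinuousOn φ X)
    (y : H) (κ : ℝ) (hκ : 0 < κ) (cP CP : ℝ)
    (hHP : AssumptionHP X φ y cP CP)
    (CTV : ℝ) (hCTV : 0 < CTV)
    (νk : Measure (EuclideanSpace ℝ (Fin d))) (hfin : IsFiniteMeasure νk)
    (hsupp : νk Xᶜ = 0) (hTV : (νk X).toReal ≤ CTV)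
    (α εk : ℝ) (hα : 0 < α) (hεk : 0 < εk)
    (Cw : ℝ) (hCw : Cw = α * (CP + CTV + κ) * Real.exp (α * (CP + CTV + κ)) * CTV) :
    ∀ t ∈ X,
      |dualCert X φ y κ (bdStep X φ y κ α εk Cw νk) t
          - dualCert X φ y κ (wUpdate X φ y κ α νk) t|
        ≤ (νk X).toReal * εk ^ 2 + (volume X).toReal * εk := by
  have hXm : MeasurableSet X := hXcomp.isClosed.measurableSet
  have hφ1 : ∀ t ∈ X, ‖φ t‖ ≤ 1 := by
    intro t ht
    have h := hHP.K_norm_one t ht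
    rw [real_inner_self_eq_norm_sq] at h
    nlinarith [norm_nonneg (φ t)]
  have hνX : νk.restrict X = νk := by
    apply Measure.restrict_eq_self_of_ae_mem
    rw [ae_iff]
    exact hsupp
  have hcont : ∀ ν : Measure (EuclideanSpace ℝ (Fin d)),
      ContinuousOn (fun t => dualCert X φ y κ ν t) X := by
    intro ν
    unfold dualCert
    exact (hφ.inner continuousOn_const).add continuousOn_const
  have hgc : ContinuousOn (fun t => Real.exp (-(α * dualCert X φ y κ νk t))) X :=
    Real.continuous_exp.comp_continuousOn ((continuousOn_const.mul (hcont νk)).neg)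
  have hgi : Integrable (fun t => Real.exp (-(α * dualCert X φ y κ νk t))) νk := by
    have := hgc.integrableOn_compact (μ := νk) hXcomp
    rwa [IntegrableOn, hνX] at this
  have hWfin : IsFiniteMeasure (wUpdate X φ y κ α νk) :=
    isFiniteMeasure_withDensity_ofReal hgi.2
  -- integrals against the weighted measure
  have hWint : ∀ A : Set (EuclideanSpace ℝ (Fin d)), MeasurableSet A →
      ∫ t in A, φ t ∂(wUpdate X φ y κ α νk)
        = ∫ t in A, Real.exp (-(α * dualCert X φ y κ νk t)) • φ t ∂νk := by
    intro A hA
    unfold wUpdate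
    rw [restrict_withDensity hA, integral_withDensity_eq_integral_toReal_smul₀]
    · simp only [ENNReal.toReal_ofReal (Real.exp_nonneg _)]
    · exact hgi.aemeasurable.ennreal_ofReal.restrict
    · exact Filter.Eventually.of_forall fun _ => ENNReal.ofReal_lt_top
  have hφW : IntegrableOn φ X (wUpdate X φ y κ α νk) := hφ.integrableOn_compact hXcomp
  have hφν : IntegrableOn φ X νk := hφ.integrableOn_compact hXcomp
  have hgφ : IntegrableOn (fun t => Real.exp (-(α * dualCert X φ y κ νk t)) • φ t) X νk :=
    (hgc.smul hφ).integrableOn_compact hXcomp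
  have hνr : νk.real X ≤ CTV := hTV
  have hΦν : ‖PhiOp X φ νk‖ ≤ CTV := by
    have := norm_setIntegral_le_of_norm_le_const (μ := νk) (measure_lt_top _ X) hφ1
    rw [one_mul] at this
    exact this.trans hνr
  have hinner : ∀ t ∈ X, ∀ v : H, |(⟪φ t, v⟫ : ℝ)| ≤ ‖v‖ := by
    intro t ht v
    calc |(⟪φ t, v⟫ : ℝ)| ≤ ‖φ t‖ * ‖v‖ := abs_real_inner_le_norm _ _
      _ ≤ 1 * ‖v‖ := by gcongr; exact hφ1 t ht
      _ = ‖v‖ := one_mul _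
  set M := CP + CTV + κ with hM
  have hJb : ∀ t ∈ X, |dualCert X φ y κ νk t| ≤ M := by
    intro t ht
    unfold dualCert
    have h1 := hinner t ht (PhiOp X φ νk - y)
    have h2 := norm_sub_le (PhiOp X φ νk) y
    have h3 := hHP.y_bdd
    have h4 := abs_add_le (⟪φ t, PhiOp X φ νk - y⟫ : ℝ) κ
    rw [abs_of_pos hκ] at h4
    linarith
  have hMpos : 0 < M := by have := hHP.CP_pos; positivity
  have hexp : ∀ t ∈ X, |Real.exp (-(α * dualCert X φ y κ νk t)) - 1|
      ≤ α * M * Real.exp (α * M) := by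
    intro t ht
    have hb := abs_le.1 (hJb t ht)
    set x := -(α * dualCert X φ y κ νk t) with hx
    have hx1 : x ≤ α * M := by rw [hx]; nlinarith
    have hx2 : -(α * M) ≤ x := by rw [hx]; nlinarith
    have hαM : 0 < α * M := by positivity
    have e1 : 1 ≤ Real.exp (α * M) := Real.one_le_exp hαM.le
    rw [abs_le]
    constructor
    · have := Real.add_one_le_exp x
      nlinarith
    · have h1 : Real.exp x ≤ Real.exp (α * M) := Real.exp_le_exp.2 hx1
      have h2 := Real.add_one_le_exp (-(α * M))
      have h3 : Real.exp (-(α * M)) * Real.exp (α * M) = 1 := by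
        rw [← Real.exp_add]; simp
      nlinarith [Real.exp_pos (α * M)]
  have hPhiDiff : ‖PhiOp X φ (wUpdate X φ y κ α νk) - PhiOp X φ νk‖ ≤ Cw := by
    unfold PhiOp
    rw [hWint X hXm, ← integral_sub hgφ hφν, hCw]
    have hB : ∀ t ∈ X, ‖Real.exp (-(α * dualCert X φ y κ νk t)) • φ t - φ t‖
        ≤ α * M * Real.exp (α * M) := by
      intro t ht
      have : Real.exp (-(α * dualCert X φ y κ νk t)) • φ t - φ t
          = (Real.exp (-(α * dualCert X φ y κ νk t)) - 1) • φ t := by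
        rw [sub_smul, one_smul]
      rw [this, norm_smul, Real.norm_eq_abs]
      calc _ ≤ |Real.exp (-(α * dualCert X φ y κ νk t)) - 1| * 1 := by
            gcongr; exact hφ1 t ht
        _ ≤ _ := by rw [mul_one]; exact hexp t ht
    refine (norm_setIntegral_le_of_norm_le_const (measure_lt_top _ X) hB).trans ?_
    gcongr
  -- density bound on the death region
  have hdens : ∀ t ∈ X, t ∈ Pset X φ y κ α εk Cw (wUpdate X φ y κ α νk) →
      Real.exp (-(α * dualCert X φ y κ νk t)) ≤ εk ^ 2 := by
    intro t ht hP
    have h1 := hP.1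
    have h2 := (hinner t ht (PhiOp X φ (wUpdate X φ y κ α νk) - PhiOp X φ νk)).trans hPhiDiff
    have h3 : dualCert X φ y κ (wUpdate X φ y κ α νk) t - dualCert X φ y κ νk t
        = ⟪φ t, PhiOp X φ (wUpdate X φ y κ α νk) - PhiOp X φ νk⟫ := by
      unfold dualCert
      simp only [inner_sub_right]
      ring
    rw [← h3] at h2
    have h4 := (abs_le.1 h2).2
    have h5 : -(2 / α) * Real.log εk ≤ dualCert X φ y κ νk t := by linarith
    have h6 : α * (-(2 / α) * Real.log εk) ≤ α * dualCert X φ y κ νk t := by gcongr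
    have h7 : α * (-(2 / α) * Real.log εk) = -(2 * Real.log εk) := by field_simp
    calc Real.exp (-(α * dualCert X φ y κ νk t)) ≤ Real.exp (2 * Real.log εk) :=
          Real.exp_le_exp.2 (by linarith)
      _ = εk ^ 2 := by
          rw [two_mul, Real.exp_add, Real.exp_log hεk]; ring
  set W := wUpdate X φ y κ α νk with hWdef
  set P := Pset X φ y κ α εk Cw W with hPdef
  set N := Nset X φ y κ W with hNdef
  have hle : ∀ c : ℝ, IsClosed (X ∩ (fun t => dualCert X φ y κ W t) ⁻¹' Iic c) := fun c =>
    (hcont W).preimage_isClosed_of_isClosed hXcomp.isClosed isClosed_Iic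
  have hXP : MeasurableSet (X ∩ Pᶜ) := by
    have : X ∩ Pᶜ = (X ∩ (fun t => dualCert X φ y κ W t) ⁻¹' Iic (-(2 / α) * Real.log εk + Cw))
        ∪ (X ∩ (fun t => dualCert X φ y κ W t) ⁻¹' Iic 0) := by
      ext t
      simp only [hPdef, Pset, mem_inter_iff, mem_compl_iff, mem_setOf_eq, mem_union, mem_preimage,
        mem_Iic, not_and_or, not_lt, gt_iff_lt]
      tauto
    rw [this]
    exact ((hle _).union (hle _)).measurableSet
  have hXP' : MeasurableSet (X ∩ P) := by
    have : X ∩ P = X \ (X ∩ Pᶜ) := by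
      ext t; simp only [mem_inter_iff, mem_diff, mem_compl_iff]; tauto
    rw [this]
    exact hXm.diff hXP
  have hNX : X ∩ N = N := by
    apply inter_eq_right.2
    intro t ht
    exact ht.1
  have hvolX : volume X < ⊤ := hXcomp.measure_lt_top
  have hφvol : IntegrableOn φ N volume :=
    (hφ.integrableOn_compact (μ := volume) hXcomp).mono_set (inter_eq_right.1 hNX)
  have hbd : PhiOp X φ (bdStep X φ y κ α εk Cw νk)
      = (∫ t in X ∩ Pᶜ, φ t ∂W) + εk • ∫ t in N, φ t := by
    unfold PhiOp bdStep
    rw [← hWdef, ← hPdef, ← hNdef, Measure.restrict_add, Measure.restrict_smul,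
      Measure.restrict_restrict hXm, Measure.restrict_restrict hXm, hNX, integral_add_measure,
      integral_smul_measure, ENNReal.toReal_ofReal hεk.le]
    · exact hφW.mono_set inter_subset_left
    · exact Integrable.smul_measure hφvol ENNReal.ofReal_ne_top
  have hsplit : PhiOp X φ W = (∫ t in X ∩ Pᶜ, φ t ∂W) + ∫ t in X ∩ P, φ t ∂W := by
    unfold PhiOp
    rw [← setIntegral_union _ hXP' (hφW.mono_set inter_subset_left)
      (hφW.mono_set inter_subset_left)]
    · rw [← inter_union_distrib_left, compl_union_self, inter_univ]
    · rw [Set.disjoint_left]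
      rintro t ⟨_, h1⟩ ⟨_, h2⟩
      exact h1 h2
  have hA : ‖∫ t in X ∩ P, φ t ∂W‖ ≤ (νk X).toReal * εk ^ 2 := by
    rw [hWint _ hXP']
    have hB : ∀ t ∈ X ∩ P, ‖Real.exp (-(α * dualCert X φ y κ νk t)) • φ t‖ ≤ εk ^ 2 := by
      intro t ht
      rw [norm_smul, Real.norm_eq_abs, abs_of_pos (Real.exp_pos _)]
      calc _ ≤ Real.exp (-(α * dualCert X φ y κ νk t)) * 1 := by
            gcongr; exact hφ1 t ht.1
        _ ≤ _ := by rw [mul_one]; exact hdens t ht.1 ht.2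
    refine (norm_setIntegral_le_of_norm_le_const (measure_lt_top _ _) hB).trans ?_
    rw [mul_comm]
    have : νk.real (X ∩ P) ≤ (νk X).toReal := measureReal_mono inter_subset_left
    gcongr
  have hBn : ‖∫ t in N, φ t‖ ≤ (volume X).toReal := by
    have hNs : N ⊆ X := inter_eq_right.1 hNX
    have := norm_setIntegral_le_of_norm_le_const (μ := volume)
      ((measure_mono hNs).trans_lt hvolX) (fun t ht => hφ1 t (hNs ht))
    rw [one_mul] at this
    exact this.trans (measureReal_mono hNs hvolX.ne)
  intro t ht
  have hfinal : dualCert X φ y κ (bdStep X φ y κ α εk Cw νk) t - dualCert X φ y κ W t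
      = ⟪φ t, (εk • ∫ t in N, φ t) - ∫ t in X ∩ P, φ t ∂W⟫ := by
    unfold dualCert
    rw [hbd, hsplit]
    simp only [inner_sub_right, inner_add_right]
    ring
  rw [hfinal]
  refine (hinner t ht _).trans ((norm_sub_le _ _).trans ?_)
  rw [norm_smul, Real.norm_eq_abs, abs_of_pos hεk]
  have : εk * ‖∫ t in N, φ t‖ ≤ εk * (volume X).toReal := by gcongr
  linarith

end
end

section
/- One-step descent driven by the negative part of the certificate: assume Assumption (H_ε) with constant C₀ > 0, Assumption (H_TV^∞) with constant C_TV > 0, ν_{k⁺} = W_{ν_k,α} ν_k for every k, and 0 < α < 1/(10(1 + C_TV + C_P + κ)(1 ∨ C_TV)). Fix k ≥ 1, set v := min(min_{t∈𝒳} J'_{ν_{(k−1)⁺}}(t), 0) and Θ := {t ∈ 𝒳 : J'_{ν_{(k−1)⁺}}(t) ≤ v/2}. If v² ≥ 24 · ε_{k−1}² · C₀², then J(ν_{k⁺}) − J(ν_k) ≤ −(1/16) · α · ε_{k−1} · v² · λ(Θ). -/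
/-!
STATEMENT 12 (One-step descent driven by the negative part of the certificate):
under (H_ε), (H_TV^∞), ν_{k⁺} = W_{ν_k,α}ν_k and the step-size condition on α, for
k ≥ 1, with v := min(min_𝒳 J′_{ν_{(k−1)⁺}}, 0) and Θ := {J′_{ν_{(k−1)⁺}} ≤ v/2}, if
v² ≥ 24 ε_{k−1}² C₀² then J(ν_{k⁺}) − J(ν_k) ≤ −(1/16)·α·ε_{k−1}·v²·λ(Θ).
-/

open MeasureTheory Set
open scoped RealInnerProductSpace ENNReal

noncomputable section

lemma aux_scalar (x c : ℝ) (hx : |x| ≤ 1 / 10) (hc0 : 0 ≤ c) (hc : c ≤ 1 / 10) :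
    (Real.exp (-x) - 1) * x + c / 2 * (Real.exp (-x) - 1) ^ 2 ≤ -(8 / 10) * x ^ 2 := by
  have h := Real.abs_exp_sub_one_sub_id_le (x := -x) (by rw [abs_neg]; linarith)
  obtain ⟨r, hr⟩ : ∃ r, r = Real.exp (-x) - 1 - -x := ⟨_, rfl⟩
  rw [← hr] at h
  have he : Real.exp (-x) - 1 = r - x := by rw [hr]; ring
  rw [he]
  have hx2 : |r| ≤ x ^ 2 := by simpa using h
  have hrx : |r| ≤ |x| / 10 := by
    have : x ^ 2 = |x| * |x| := by rw [← sq, sq_abs]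
    nlinarith [abs_nonneg x]
  have h1 : r * x ≤ x ^ 2 / 10 := by
    calc r * x ≤ |r * x| := le_abs_self _
      _ = |r| * |x| := abs_mul _ _
      _ ≤ |x| / 10 * |x| := by gcongr
      _ = x ^ 2 / 10 := by rw [← sq_abs x]; ring
  have h2 : (r - x) ^ 2 ≤ (11 / 10 * |x|) ^ 2 := by
    rw [← sq_abs (r - x)]
    have := abs_sub r x
    gcongr
    linarith
  rw [mul_pow, sq_abs] at h2
  have h3 : c / 2 * (r - x) ^ 2 ≤ 1 / 20 * ((11 / 10) ^ 2 * x ^ 2) := by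
    apply mul_le_mul _ h2 (sq_nonneg _) (by norm_num)
    linarith
  nlinarith [sq_nonneg x]

lemma dualCert_contOn {d : ℕ} {H : Type*} [NormedAddCommGroup H] [InnerProductSpace ℝ H]
    (X : Set (EuclideanSpace ℝ (Fin d))) (φ : EuclideanSpace ℝ (Fin d) → H)
    (hφ : ContinuousOn φ X)
    (y : H) (κ : ℝ) (ν : Measure (EuclideanSpace ℝ (Fin d))) :
    ContinuousOn (dualCert X φ y κ ν) X :=
  (hφ.inner continuousOn_const).add continuousOn_const

lemma aux_descent {d : ℕ} {H : Type*} [NormedAddCommGroup H] [InnerProductSpace ℝ H]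
    [CompleteSpace H]
    (X : Set (EuclideanSpace ℝ (Fin d))) (hX : IsCompact X)
    (φ : EuclideanSpace ℝ (Fin d) → H) (hφ : ContinuousOn φ X)
    (hφ1 : ∀ t ∈ X, ‖φ t‖ = 1)
    (y : H) (κ : ℝ) (hκ : 0 < κ) (CP CTV : ℝ) (hCP : 0 < CP) (hy : ‖y‖ ≤ CP) (hCTV : 0 < CTV)
    (α : ℝ) (hα0 : 0 < α) (hα1 : α * (CTV + CP + κ) ≤ 1 / 10) (hα2 : α * CTV ≤ 1 / 10)
    (ν : Measure (EuclideanSpace ℝ (Fin d))) [IsFiniteMeasure ν]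
    (hTV : (ν X).toReal ≤ CTV) :
    Jobj X φ y κ (wUpdate X φ y κ α ν) - Jobj X φ y κ ν
      ≤ ∫ t in X, -(8 / 10) * α * (dualCert X φ y κ ν t) ^ 2 ∂ν := by
  have hXm : MeasurableSet X := hX.measurableSet
  set g := dualCert X φ y κ ν with hg
  have hgc : ContinuousOn g X := dualCert_contOn X φ hφ y κ ν
  set e : EuclideanSpace ℝ (Fin d) → ℝ := fun t => Real.exp (-(α * g t)) with he
  have hec : ContinuousOn e X := Real.continuous_exp.comp_continuousOn
    (continuousOn_const.mul hgc).neg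
  have hme : AEMeasurable (fun t => ENNReal.ofReal (e t)) (ν.restrict X) :=
    ENNReal.measurable_ofReal.comp_aemeasurable (hec.aemeasurable hXm)
  have hint : ∀ {E : Type _} [NormedAddCommGroup E] (f : EuclideanSpace ℝ (Fin d) → E),
      ContinuousOn f X → Integrable f (ν.restrict X) := fun f hf =>
    hf.integrableOn_compact hX
  have hint' : ∀ f : EuclideanSpace ℝ (Fin d) → ℝ,
      ContinuousOn f X → Integrable f (ν.restrict X) := fun f hf =>
    hf.integrableOn_compact hX
  set P := PhiOp X φ ν with hP
  have hP' : PhiOp X φ (wUpdate X φ y κ α ν) = ∫ t in X, e t • φ t ∂ν := by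
    unfold PhiOp wUpdate
    rw [restrict_withDensity hXm, integral_withDensity_eq_integral_toReal_smul₀ hme
      (by simp)]
    refine integral_congr_ae (Filter.Eventually.of_forall fun t => ?_)
    simp only
    rw [ENNReal.toReal_ofReal (Real.exp_pos _).le]
  have hmass : ((wUpdate X φ y κ α ν) X).toReal = ∫ t in X, e t ∂ν := by
    unfold wUpdate
    rw [withDensity_apply _ hXm, integral_eq_lintegral_of_nonneg_ae
      (Filter.Eventually.of_forall fun t => (Real.exp_pos _).le)
      (hint' e hec).aestronglyMeasurable]
  have hmass0 : (ν X).toReal = ∫ t in X, (1 : ℝ) ∂ν := by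
    simp [Measure.real]
  set D := ∫ t in X, (e t - 1) • φ t ∂ν with hD
  have hwc : ContinuousOn (fun t => e t - 1) X := hec.sub continuousOn_const
  have hDint : Integrable (fun t => (e t - 1) • φ t) (ν.restrict X) := hint _ (hwc.smul hφ)
  have hDP : PhiOp X φ (wUpdate X φ y κ α ν) = P + D := by
    rw [hP', hP, hD, PhiOp, ← integral_add (hint _ hφ) hDint]
    congr 1; ext t; rw [sub_smul, one_smul]; abel
  have hin : ∀ z : H, ⟪z, D⟫ = ∫ t in X, (e t - 1) * ⟪φ t, z⟫ ∂ν := by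
    intro z
    rw [hD, ← integral_inner hDint]
    congr 1; ext t; rw [real_inner_smul_right, real_inner_comm]
  have i1 : Integrable (fun t => CTV / 2 * (e t - 1) ^ 2) (ν.restrict X) :=
    hint' _ (continuousOn_const.mul (hwc.pow 2))
  have i2 : ∀ z : H, Integrable (fun t => (e t - 1) * ⟪φ t, z⟫) (ν.restrict X) := fun z =>
    hint' _ (hwc.mul (hφ.inner continuousOn_const))
  have i3 : Integrable (fun t => (e t - 1) * g t) (ν.restrict X) := hint' _ (hwc.mul hgc)
  have i4 : Integrable (fun t => κ * (e t - 1)) (ν.restrict X) :=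
    hint' _ (continuousOn_const.mul hwc)
  have hDsq : 1 / 2 * ‖D‖ ^ 2 ≤ ∫ t in X, CTV / 2 * (e t - 1) ^ 2 ∂ν := by
    have h1 : ‖D‖ ^ 2 ≤ ∫ t in X, (CTV / 2 * (e t - 1) ^ 2 + ‖D‖ ^ 2 / (2 * CTV)) ∂ν := by
      refine (real_inner_self_eq_norm_sq D).symm.le.trans ?_
      refine (hin D).le.trans ?_
      refine setIntegral_mono_on (hint' _ (hwc.mul (hφ.inner continuousOn_const)))
        (hint' _ ((continuousOn_const.mul (hwc.pow 2)).add continuousOn_const)) hXm ?_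
      intro t ht
      have h2 : |⟪φ t, D⟫| ≤ ‖D‖ := by
        simpa [hφ1 t ht] using abs_real_inner_le_norm (φ t) D
      have h3 : ⟪φ t, D⟫ ^ 2 ≤ ‖D‖ ^ 2 := by
        rw [← sq_abs ⟪φ t, D⟫]; gcongr
      have h4 : (e t - 1) * ⟪φ t, D⟫ ≤
          CTV / 2 * (e t - 1) ^ 2 + ⟪φ t, D⟫ ^ 2 / (2 * CTV) := by
        have : CTV / 2 * (e t - 1) ^ 2 + ⟪φ t, D⟫ ^ 2 / (2 * CTV) - (e t - 1) * ⟪φ t, D⟫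
          = (CTV * (e t - 1) - ⟪φ t, D⟫) ^ 2 / (2 * CTV) := by field_simp; ring
        have h5 : 0 ≤ (CTV * (e t - 1) - ⟪φ t, D⟫) ^ 2 / (2 * CTV) := by positivity
        linarith
      refine h4.trans ?_
      gcongr
    rw [integral_add i1 (hint' _ continuousOn_const), setIntegral_const, smul_eq_mul, Measure.real] at h1
    have h6 : (ν X).toReal * (‖D‖ ^ 2 / (2 * CTV)) ≤ CTV * (‖D‖ ^ 2 / (2 * CTV)) := by gcongr
    have h7 : CTV * (‖D‖ ^ 2 / (2 * CTV)) = ‖D‖ ^ 2 / 2 := by field_simp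
    linarith
  have hJ : Jobj X φ y κ (wUpdate X φ y κ α ν) - Jobj X φ y κ ν
      = (∫ t in X, (e t - 1) * g t ∂ν) + 1 / 2 * ‖D‖ ^ 2 := by
    have h1 : (∫ t in X, (e t - 1) * g t ∂ν) = ⟪P - y, D⟫ + κ * (∫ t in X, (e t - 1) ∂ν) := by
      rw [hin, ← integral_const_mul, ← integral_add
        (i2 _) i4]
      congr 1; ext t
      rw [hg, dualCert]; ring
    rw [h1, integral_sub (hint' _ hec) (hint' _ continuousOn_const), ← hmass, ← hmass0]
    unfold Jobj
    rw [hDP, ← hP, show y - (P + D) = -((P - y) + D) by abel, norm_neg,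
      show y - P = -(P - y) by abel, norm_neg, norm_add_sq_real]
    ring
  rw [hJ]
  have hfin : (∫ t in X, (e t - 1) * g t ∂ν) + ∫ t in X, CTV / 2 * (e t - 1) ^ 2 ∂ν
      ≤ ∫ t in X, -(8 / 10) * α * (g t) ^ 2 ∂ν := by
    rw [← integral_add i3 i1]
    refine setIntegral_mono_on (hint' _ ((hwc.mul hgc).add
      (continuousOn_const.mul (hwc.pow 2)))) (hint' _ (continuousOn_const.mul (hgc.pow 2))) hXm ?_
    intro t ht
    have hPn : ‖P‖ ≤ CTV := by
      have := norm_setIntegral_le_of_norm_le_const (μ := ν) (s := X) (f := φ) (C := 1)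
        (measure_lt_top _ _) (fun t ht => (hφ1 t ht).le)
      rw [one_mul] at this
      exact this.trans hTV
    have hgb : |g t| ≤ CTV + CP + κ := by
      have h1 : |⟪φ t, P - y⟫| ≤ ‖P - y‖ := by
        simpa [hφ1 t ht] using abs_real_inner_le_norm (φ t) (P - y)
      have h2 := norm_sub_le P y
      have h3 : |g t| ≤ |⟪φ t, P - y⟫| + |κ| := abs_add_le _ _
      rw [abs_of_pos hκ] at h3
      linarith
    have hs := aux_scalar (α * g t) (α * CTV) (by
      rw [abs_mul, abs_of_pos hα0]
      exact (mul_le_mul_of_nonneg_left hgb hα0.le).trans hα1) (by positivity) hα2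
    have : e t = Real.exp (-(α * g t)) := rfl
    rw [← this] at hs
    refine le_of_mul_le_mul_left ?_ hα0
    nlinarith
  linarith

theorem one_step_descent_negative_certificate
    {d : ℕ} {H : Type*} [NormedAddCommGroup H] [InnerProductSpace ℝ H] [CompleteSpace H]
    [TopologicalSpace.SeparableSpace H]
    (hd : 1 ≤ d)
    (X : Set (EuclideanSpace ℝ (Fin d))) (hXcomp : IsCompact X) (hXconv : Convex ℝ X)
    (hXint : (interior X).Nonempty)
    (φ : EuclideanSpace ℝ (Fin d) → H) (hφ : ContinuousOn φ X)
    (y : H) (κ : ℝ) (hκ : 0 < κ) (cP CP : ℝ)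
    (hHP : AssumptionHP X φ y cP CP)
    (C₀ CTV : ℝ) (hC₀ : 0 < C₀) (hCTV : 0 < CTV)
    (α : ℝ) (hα0 : 0 < α) (hα : α < 1 / (10 * (1 + CTV + CP + κ) * max 1 CTV))
    (ν νp : ℕ → Measure (EuclideanSpace ℝ (Fin d)))
    (ε : ℕ → ℝ) (hεpos : ∀ k, 0 < ε k)
    (hfin : ∀ k, IsFiniteMeasure (ν k)) (hsupp : ∀ k, ν k Xᶜ = 0)
    (hW : ∀ k, νp k = wUpdate X φ y κ α (ν k))
    (hTV : ∀ k, ((ν k) X).toReal ≤ CTV)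
    (hε1 : ∀ k, Jobj X φ y κ (ν (k + 1)) - Jobj X φ y κ (νp k) ≤ C₀ * (ε k) ^ 2)
    (hε2 : ∀ k, ∀ t ∈ X,
      |dualCert X φ y κ (ν (k + 1)) t - dualCert X φ y κ (νp k) t| ≤ C₀ * ε k)
    (hε3 : ∀ k, ∀ B : Set (EuclideanSpace ℝ (Fin d)), MeasurableSet B → B ⊆ X →
      ENNReal.ofReal (ε k) * volume (B ∩ {t | dualCert X φ y κ (νp k) t ≤ 0})
        ≤ ν (k + 1) B)
    (k : ℕ) (hk : 1 ≤ k)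
    (v : ℝ) (hv : v = min (sInf ((fun t => dualCert X φ y κ (νp (k - 1)) t) '' X)) 0)
    (hvbig : 24 * (ε (k - 1)) ^ 2 * C₀ ^ 2 ≤ v ^ 2) :
    Jobj X φ y κ (νp k) - Jobj X φ y κ (ν k)
      ≤ -(1 / 16) * α * ε (k - 1) * v ^ 2 *
          (volume {t ∈ X | dualCert X φ y κ (νp (k - 1)) t ≤ v / 2}).toReal := by
  have hHP1 : ∀ t ∈ X, ‖φ t‖ = 1 := by
    intro t ht
    have := hHP.K_norm_one t ht
    rw [real_inner_self_eq_norm_sq] at this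
    nlinarith [norm_nonneg (φ t)]
  have hCP := hHP.CP_pos
  obtain ⟨n, rfl⟩ : ∃ n, k = n + 1 := ⟨k - 1, by omega⟩
  simp only [Nat.add_sub_cancel] at hv hvbig ⊢
  have hm1 : 1 ≤ max 1 CTV := le_max_left _ _
  have hm2 : CTV ≤ max 1 CTV := le_max_right _ _
  rw [lt_div_iff₀ (by positivity)] at hα
  have hα1 : α * (CTV + CP + κ) ≤ 1 / 10 := by
    have h1 : (1 + CTV + CP + κ) * 1 ≤ (1 + CTV + CP + κ) * max 1 CTV := by gcongr
    have h2 := mul_le_mul_of_nonneg_left h1 hα0.le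
    nlinarith
  have hα2 : α * CTV ≤ 1 / 10 := by
    nlinarith [mul_pos hα0 hCP, mul_pos hα0 hκ]
  haveI := hfin (n + 1)
  have hdesc := aux_descent X hXcomp φ hφ hHP1 y κ hκ CP CTV hCP hHP.y_bdd hCTV α hα0 hα1 hα2
    (ν (n + 1)) (hTV _)
  rw [← hW] at hdesc
  refine hdesc.trans ?_
  set Θ := {t ∈ X | dualCert X φ y κ (νp n) t ≤ v / 2} with hΘ
  have hv0 : v ≤ 0 := by rw [hv]; exact min_le_right _ _
  have hΘX : Θ ⊆ X := fun t ht => ht.1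
  have hΘm : MeasurableSet Θ :=
    ((dualCert_contOn X φ hφ y κ (νp n)).preimage_isClosed_of_isClosed hXcomp.isClosed
      (isClosed_Iic (a := v / 2))).measurableSet
  have hmeas := hε3 n Θ hΘm hΘX
  rw [inter_eq_left.mpr (fun t ht => by
    have := ht.2; simp only [mem_setOf_eq]; linarith)] at hmeas
  have hmeas' : ε n * (volume Θ).toReal ≤ (ν (n + 1)).real Θ := by
    have := ENNReal.toReal_mono (measure_ne_top _ _) hmeas
    rwa [ENNReal.toReal_mul, ENNReal.toReal_ofReal (hεpos n).le] at this
  have hgc := dualCert_contOn X φ hφ y κ (ν (n + 1))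
  have hgint : IntegrableOn (fun t => (dualCert X φ y κ (ν (n + 1)) t) ^ 2) X (ν (n + 1)) :=
    (hgc.pow 2).integrableOn_compact hXcomp
  have hb : C₀ * ε n ≤ 5 / 24 * (-v) := by
    refine abs_le_of_sq_le_sq' (a := C₀ * ε n) ?_ (by linarith) |>.2
    nlinarith [sq_nonneg v]
  have hlow : 8 / 100 * v ^ 2 * (ν (n + 1)).real Θ
      ≤ ∫ t in X, (dualCert X φ y κ (ν (n + 1)) t) ^ 2 ∂(ν (n + 1)) := by
    calc 8 / 100 * v ^ 2 * (ν (n + 1)).real Θ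
        = ∫ t in Θ, 8 / 100 * v ^ 2 ∂(ν (n + 1)) := by
          rw [setIntegral_const, smul_eq_mul, mul_comm]
      _ ≤ ∫ t in Θ, (dualCert X φ y κ (ν (n + 1)) t) ^ 2 ∂(ν (n + 1)) := by
          refine setIntegral_mono_on (integrable_const _) (hgint.mono_set hΘX) hΘm ?_
          intro t ht
          have h1 := (abs_le.1 (hε2 n t ht.1)).2
          have h2 := ht.2
          have h3 : dualCert X φ y κ (ν (n + 1)) t ≤ 7 / 24 * v := by linarith
          nlinarith [sq_nonneg v]
      _ ≤ _ := setIntegral_mono_set hgint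
          (Filter.Eventually.of_forall fun t => sq_nonneg _) hΘX.eventuallyLE
  rw [integral_const_mul]
  have h9 : 8 / 100 * v ^ 2 * (ε n * (volume Θ).toReal) ≤ _ :=
    (mul_le_mul_of_nonneg_left hmeas' (by positivity)).trans hlow
  have h10 := mul_le_mul_of_nonneg_left h9 hα0.le
  have h11 : 0 ≤ α * (v ^ 2 * (ε n * (volume Θ).toReal)) := by
    have := hεpos n
    positivity
  nlinarith

end
end

section
/- Total-variation stability of the stochastic weight update with mass injection: let G ∈ (0,1], H > 0, κ ≥ 0 and α > 0, and set ℜ̂ := (H/G)·e + √(e³/G) + 1. Let (ν_k)_{k≥0} be finite nonnegative Borel measures on 𝒳 and, for each k, let Ĵ_k : 𝒳 → ℝ be a measurable function such that Ĵ_k(t) ≥ G‖ν_k‖_TV − H + κ for all t ∈ 𝒳, and suppose ‖ν_{k+1}‖_TV ≤ ∫_𝒳 e^{−α Ĵ_k(t)} dν_k(t) + ε_k with 0 < ε_k ≤ α for every k. If α ≤ 1/(1 + ℜ̂), then ‖ν_k‖_TV ≤ ‖ν₀‖_TV ∨ 2ℜ̂ for all k ≥ 0. -/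
/-!
STATEMENT 18 (Total-variation stability of the stochastic weight update with mass
injection): with ℜ̂ := (H/G)e + √(e³/G) + 1, if each stochastic certificate satisfies
Ĵ_k(t) ≥ G‖ν_k‖_TV − H + κ, the masses satisfy
‖ν_{k+1}‖_TV ≤ ∫ e^{−αĴ_k} dν_k + ε_k with 0 < ε_k ≤ α, and α ≤ 1/(1+ℜ̂), then
‖ν_k‖_TV ≤ ‖ν₀‖_TV ∨ 2ℜ̂ for all k ≥ 0.
-/

open MeasureTheory Set

noncomputable section

theorem tv_aux (G Hc α R s m E : ℝ) (hG0 : 0 < G) (hG1 : G ≤ 1) (hH : 0 < Hc) (hα : 0 < α)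
    (hs0 : 0 ≤ s) (hs : 4 ≤ G * s ^ 2) (hR : 5 / 2 * Hc + G * s + G ≤ G * R) (hRs : s + 1 ≤ R)
    (hRH : 5 / 2 * Hc ≤ R)
    (hαR : α * (1 + R) ≤ 1) (hm : 0 ≤ m) (hE : E = Real.exp (-(α * (G * m - Hc)))) :
    m * E + α ≤ max m (2 * R) := by
  have hs2 : 2 ≤ s := by nlinarith
  have hα4 : α ≤ 1 / 4 := by nlinarith
  have hE0 : 0 < E := hE ▸ Real.exp_pos _
  rcases le_total R m with h | h
  · apply le_max_of_le_left
    set x := G * m - Hc with hx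
    have hxs : G * s ≤ x := by nlinarith
    have hx0 : 0 ≤ x := le_trans (by positivity) hxs
    have hmx : 4 ≤ m * x := by
      have : s * (G * s) ≤ m * x := mul_le_mul (by linarith) hxs (by positivity) hm
      nlinarith
    have hE1 : E * (1 + α * x) ≤ 1 := by
      have h1 : α * x + 1 ≤ Real.exp (α * x) := Real.add_one_le_exp _
      have h2 : E * Real.exp (α * x) = 1 := by rw [hE, ← Real.exp_add]; simp
      nlinarith
    have hy0 : 0 ≤ α * x := by positivity
    rcases le_total (α * x) 1 with hy | hy
    · have h3 : E ≤ 1 - α * x / 2 := by nlinarith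
      have h4 : m * E ≤ m * (1 - α * x / 2) := mul_le_mul_of_nonneg_left h3 hm
      nlinarith
    · have h3 : E ≤ 1 / 2 := by nlinarith
      nlinarith
  · apply le_max_of_le_right
    have hy : α * Hc ≤ 2 / 5 := by nlinarith
    have hz : 0 ≤ α * G * m := by positivity
    have hE1 : E ≤ 5 / 3 := by
      have h1 := Real.add_one_le_exp (α * (G * m - Hc))
      have h2 : E * Real.exp (α * (G * m - Hc)) = 1 := by rw [hE, ← Real.exp_add]; simp
      nlinarith
    nlinarith

theorem tv_stability_stochastic_update
    {X : Type*} [MetricSpace X] [CompactSpace X] [MeasurableSpace X] [BorelSpace X]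
    (G Hc κ α : ℝ) (hG0 : 0 < G) (hG1 : G ≤ 1) (hH : 0 < Hc) (hκ : 0 ≤ κ) (hα : 0 < α)
    (R : ℝ) (hR : R = Hc / G * Real.exp 1 + Real.sqrt (Real.exp 3 / G) + 1)
    (ν : ℕ → Measure X) (hfin : ∀ k, IsFiniteMeasure (ν k))
    (Jhat : ℕ → X → ℝ) (hJmeas : ∀ k, Measurable (Jhat k))
    (hJlow : ∀ k, ∀ t : X, G * ((ν k) univ).toReal - Hc + κ ≤ Jhat k t)
    (ε : ℕ → ℝ) (hε : ∀ k, 0 < ε k ∧ ε k ≤ α)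
    (hrec : ∀ k, ((ν (k + 1)) univ).toReal
      ≤ (∫ t, Real.exp (-(α * Jhat k t)) ∂ν k) + ε k)
    (hαR : α ≤ 1 / (1 + R)) :
    ∀ k, ((ν k) univ).toReal ≤ max ((ν 0) univ).toReal (2 * R) := by
  have he : (5 / 2 : ℝ) ≤ Real.exp 1 := by linarith [Real.exp_one_gt_d9]
  have he3 : (4 : ℝ) ≤ Real.exp 3 := by linarith [Real.add_one_le_exp (3 : ℝ)]
  set s := Real.sqrt (Real.exp 3 / G) with hs
  have hs0 : 0 ≤ s := Real.sqrt_nonneg _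
  have hs2 : G * s ^ 2 = Real.exp 3 := by
    rw [hs, Real.sq_sqrt (by positivity)]; field_simp
  have hGR : G * R = Hc * Real.exp 1 + G * s + G := by rw [hR]; field_simp
  have hHG : Hc ≤ Hc / G := by
    rw [le_div_iff₀ hG0]; nlinarith
  have hq : 5 / 2 * Hc ≤ Hc / G * Real.exp 1 := by nlinarith
  have hα' : α * (1 + R) ≤ 1 := by
    rwa [le_div_iff₀ (by nlinarith)] at hαR
  intro k
  induction k with
  | zero => exact le_max_left _ _
  | succ k ih =>
    have := hfin k
    set m := ((ν k) univ).toReal with hm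
    have hm0 : 0 ≤ m := ENNReal.toReal_nonneg
    have hint : (∫ t, Real.exp (-(α * Jhat k t)) ∂ν k)
        ≤ ∫ _t, Real.exp (-(α * (G * m - Hc))) ∂ν k := by
      apply integral_mono_of_nonneg
      · exact Filter.Eventually.of_forall fun t => (Real.exp_pos _).le
      · exact integrable_const _
      · refine Filter.Eventually.of_forall fun t => ?_
        have h1 := hJlow k t
        apply Real.exp_le_exp.mpr
        nlinarith
    rw [integral_const, smul_eq_mul, Measure.real, ← hm] at hint
    have h2 := tv_aux G Hc α R s m _ hG0 hG1 hH hα hs0 (by linarith) (by nlinarith)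
      (by nlinarith) (by linarith) hα' hm0 rfl
    have h3 := hrec k
    have h4 := (hε k).2
    have h5 : max m (2 * R) ≤ max ((ν 0) univ).toReal (2 * R) :=
      max_le ih (le_max_right _ _)
    linarith

end
end
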